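/- arXiv:1812.10458 — 2 statements merged into one kernel-verified Lean document; each statement's English description precedes it below -/
import Mathlib

section
/- Let (x_n)_{n≥1} be a sequence in the d-dimensional torus 𝕋^d = ℝ^d/ℤ^d. Suppose that for every real s > 0, the limit as N → ∞ of (1/N)·#{(m,n) : 1 ≤ m ≠ n ≤ N, dist(x_m, x_n) ≤ s·N^{-1/d}} equals ω_d·s^d, where dist denotes the Euclidean distance on the torus (i.e. dist(x,y) = min over k ∈ ℤ^d of the Euclidean norm of x − y − k) and ω_d is the Lebesgue volume of the Euclidean unit ball in ℝ^d. Then the sequence (x_n) is uniformly distributed in 𝕋^d, i.e. for every box B = ∏_{i=1}^d [a_i, b_i] ⊆ [0,1]^d one has lim_{N→∞} (1/N)·#{1 ≤ n ≤ N : x_n ∈ B} = ∏_{i=1}^d (b_i − a_i). -/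
open Filter MeasureTheory

/-- The Euclidean (ℓ²) norm of a vector in ℝ^d. -/
noncomputable def e2norm {d : ℕ} (v : Fin d → ℝ) : ℝ := Real.sqrt (∑ i, (v i) ^ 2)

/-- The Euclidean distance on the torus ℝ^d/ℤ^d:
`dist(x,y) = inf over k ∈ ℤ^d of ‖x - y - k‖₂`. -/
noncomputable def torusDist {d : ℕ} (x y : Fin d → ℝ) : ℝ :=
  ⨅ k : Fin d → ℤ, e2norm (fun i => x i - y i - (k i : ℝ))

/-- ω_d : the Lebesgue volume of the unit Euclidean ball in ℝ^d. -/
noncomputable def unitBallVol (d : ℕ) : ℝ :=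
  (volume {v : Fin d → ℝ | e2norm v ≤ 1}).toReal

namespace PPC

abbrev E (d : ℕ) := EuclideanSpace ℝ (Fin d)

noncomputable def phi {d : ℕ} (R : ℝ) (v : E d) : ℝ := max 0 (1 - ‖v‖ / R)

lemma phi_nonneg {d : ℕ} (R : ℝ) (v : E d) : 0 ≤ phi R v := le_max_left _ _

lemma phi_le_one {d : ℕ} {R : ℝ} (hR : 0 < R) (v : E d) : phi R v ≤ 1 := by
  unfold phi
  have : 0 ≤ ‖v‖ / R := by positivity
  exact max_le (by norm_num) (by linarith)

lemma phi_cont {d : ℕ} (R : ℝ) : Continuous (phi (d := d) R) := by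
  unfold phi; fun_prop

lemma phi_zero {d : ℕ} {R : ℝ} (hR : 0 < R) {v : E d} (h : R ≤ ‖v‖) : phi R v = 0 := by
  unfold phi
  have : 1 ≤ ‖v‖ / R := by rwa [le_div_iff₀ hR, one_mul]
  exact max_eq_left (by linarith)

lemma phi_lip {d : ℕ} {R : ℝ} (hR : 0 < R) (v w : E d) :
    |phi R v - phi R w| ≤ ‖v - w‖ / R := by
  unfold phi
  refine (abs_max_sub_max_le_max _ _ _ _).trans ?_
  have h : |(1 - ‖v‖ / R) - (1 - ‖w‖ / R)| ≤ ‖v - w‖ / R := by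
    have : (1 - ‖v‖ / R) - (1 - ‖w‖ / R) = (‖w‖ - ‖v‖) / R := by ring
    rw [this, abs_div, abs_of_pos hR, norm_sub_rev]
    gcongr
    exact abs_norm_sub_norm_le w v
  simp only [sub_self, abs_zero]
  exact max_le (by positivity) h

lemma phi_neg {d : ℕ} (R : ℝ) (v : E d) : phi R (-v) = phi R v := by simp [phi]

lemma phi_hcs {d : ℕ} {R : ℝ} (hR : 0 < R) : HasCompactSupport (phi (d := d) R) := by
  refine HasCompactSupport.intro (isCompact_closedBall (0 : E d) R) ?_
  intro v hv
  apply phi_zero hR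
  simp at hv
  exact hv.le

lemma phi_int {d : ℕ} {R : ℝ} (hR : 0 < R) : Integrable (phi (d := d) R) :=
  (phi_cont R).integrable_of_hasCompactSupport (phi_hcs hR)

noncomputable def lam (d : ℕ) (R : ℝ) : ℝ := ∫ v : E d, phi R v

noncomputable def G {d : ℕ} (R : ℝ) (w : E d) : ℝ := ∫ u : E d, phi R u * phi R (u - w)

lemma lam_nonneg (d : ℕ) (R : ℝ) : 0 ≤ lam d R := integral_nonneg (phi_nonneg R)

lemma G_int {d : ℕ} {R : ℝ} (hR : 0 < R) (w : E d) :
    Integrable (fun u : E d => phi R u * phi R (u - w)) := by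
  refine Continuous.integrable_of_hasCompactSupport ?_ ((phi_hcs hR).mul_right)
  have := phi_cont (d := d) R
  fun_prop

lemma G_nonneg {d : ℕ} (R : ℝ) (w : E d) : 0 ≤ G R w :=
  integral_nonneg fun _ => mul_nonneg (phi_nonneg _ _) (phi_nonneg _ _)

lemma G_zero {d : ℕ} {R : ℝ} (hR : 0 < R) {w : E d} (h : 2 * R ≤ ‖w‖) : G R w = 0 := by
  unfold G
  rw [← integral_zero (E d) ℝ]
  congr 1
  ext u
  by_cases hu : R ≤ ‖u‖
  · rw [phi_zero hR hu, zero_mul]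
  · have : R ≤ ‖u - w‖ := by
      have := norm_sub_norm_le w u
      rw [norm_sub_rev] at this
      linarith
    rw [phi_zero hR this, mul_zero]

lemma G_zero_le {d : ℕ} {R : ℝ} (hR : 0 < R) : G R (0 : E d) ≤ lam d R := by
  unfold G lam
  refine integral_mono (G_int hR 0) (phi_int hR) fun u => ?_
  exact mul_le_of_le_one_right (phi_nonneg _ _) (phi_le_one hR _)

lemma G_lip {d : ℕ} {R : ℝ} (hR : 0 < R) (w w' : E d) :
    |G R w - G R w'| ≤ lam d R / R * ‖w - w'‖ := by
  unfold G
  rw [← integral_sub (G_int hR w) (G_int hR w')]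
  refine (abs_integral_le_integral_abs).trans ?_
  have : lam d R / R * ‖w - w'‖ = ∫ u : E d, phi R u * (‖w - w'‖ / R) := by
    rw [integral_mul_const, lam]; ring
  rw [this]
  refine integral_mono ((G_int hR w).sub (G_int hR w')).abs ((phi_int hR).mul_const _) fun u => ?_
  simp only
  rw [← mul_sub, abs_mul, abs_of_nonneg (phi_nonneg _ _)]
  refine mul_le_mul_of_nonneg_left ?_ (phi_nonneg _ _)
  refine (phi_lip hR _ _).trans ?_
  rw [sub_sub_sub_cancel_left, norm_sub_rev]

lemma G_radial {d : ℕ} (R : ℝ) {w w' : E d} (h : ‖w‖ = ‖w'‖) : G R w = G R w' := by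
  let T : E d ≃ₗᵢ[ℝ] E d := (ℝ ∙ (w - w'))ᗮ.reflection
  have hT : T w = w' := Submodule.reflection_sub h
  unfold G
  rw [← (T.measurePreserving).integral_comp T.toHomeomorph.measurableEmbedding
    (fun u => phi R u * phi R (u - w'))]
  congr 1
  ext u
  rw [← hT, ← map_sub]
  simp only [phi, LinearIsometryEquiv.norm_map]

lemma G_cont {d : ℕ} {R : ℝ} (hR : 0 < R) : Continuous (G (d := d) R) := by
  have : LipschitzWith (Real.toNNReal (lam d R / R)) (G (d := d) R) := by
    refine LipschitzWith.of_dist_le_mul fun w w' => ?_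
    rw [Real.coe_toNNReal _ (div_nonneg (lam_nonneg _ _) hR.le), Real.dist_eq, dist_eq_norm]
    exact G_lip hR w w'
  exact this.continuous

lemma G_integrable {d : ℕ} {R : ℝ} (hR : 0 < R) : Integrable (G (d := d) R) := by
  refine (G_cont hR).integrable_of_hasCompactSupport ?_
  refine HasCompactSupport.intro (isCompact_closedBall (0 : E d) (2 * R)) ?_
  intro v hv
  apply G_zero hR
  simp at hv
  exact hv.le

lemma G_integral {d : ℕ} {R : ℝ} (hR : 0 < R) : ∫ w : E d, G R w = lam d R ^ 2 := by
  have h := integral_convolution (ContinuousLinearMap.mul ℝ ℝ) (μ := (volume : Measure (E d)))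
    (ν := (volume : Measure (E d))) (phi_int (d := d) hR) (phi_int (d := d) hR)
  have e : G (d := d) R = convolution (phi R) (phi R) (ContinuousLinearMap.mul ℝ ℝ) volume := by
    ext w
    simp only [G, convolution, ContinuousLinearMap.mul_apply']
    congr 1
    ext u
    rw [← phi_neg R (u - w), neg_sub]
  rw [e, h, lam, sq]
  rfl

lemma lam_ge {d : ℕ} (hd : 1 ≤ d) :
    ∃ c : ℝ, 0 < c ∧ ∀ R : ℝ, 1 ≤ R → c * R ≤ lam d R := by
  have : Nonempty (Fin d) := ⟨⟨0, hd⟩⟩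
  refine ⟨1 / 2 * (1/2)^d * (volume (Metric.ball (0 : E d) 1)).toReal, ?_, ?_⟩
  · have : 0 < (volume (Metric.ball (0 : E d) 1)).toReal :=
      ENNReal.toReal_pos (Metric.measure_ball_pos _ _ one_pos).ne' measure_ball_lt_top.ne
    positivity
  · intro R hR
    have hR0 : 0 < R := by linarith
    have h1 : ∫ v in Metric.closedBall (0 : E d) (R / 2), (1 / 2 : ℝ) ≤ lam d R := by
      unfold lam
      refine le_trans ?_ (setIntegral_le_integral (phi_int hR0)
        (Eventually.of_forall (phi_nonneg R)) (s := Metric.closedBall (0 : E d) (R / 2)))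
      refine setIntegral_mono_on ?_ (phi_int hR0).integrableOn measurableSet_closedBall ?_
      · exact (continuous_const.continuousOn).integrableOn_compact (isCompact_closedBall _ _)
      · intro v hv
        simp at hv
        unfold phi
        refine le_max_of_le_right ?_
        have : ‖v‖ / R ≤ 1 / 2 := by
          rw [div_le_iff₀ hR0]; linarith
        linarith
    refine le_trans ?_ h1
    rw [setIntegral_const, Measure.real, Measure.addHaar_closedBall _ _ (by positivity)]
    rw [ENNReal.toReal_mul, ENNReal.toReal_ofReal (by positivity)]
    simp only [finrank_euclideanSpace, Fintype.card_fin, smul_eq_mul]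
    have hp : R ≤ R ^ d := le_self_pow₀ hR (by omega)
    have hv : 0 ≤ (volume (Metric.ball (0 : E d) 1)).toReal := ENNReal.toReal_nonneg
    calc _ = (1/2) * (1/2)^d * (volume (Metric.ball (0 : E d) 1)).toReal * R := by ring
      _ ≤ (1/2) * (1/2)^d * (volume (Metric.ball (0 : E d) 1)).toReal * R^d := by gcongr
      _ = _ := by rw [div_pow, div_pow]; ring

lemma e2norm_eq {d : ℕ} (v : Fin d → ℝ) : e2norm v = ‖(WithLp.toLp 2 v : E d)‖ := by
  rw [EuclideanSpace.norm_eq, e2norm]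
  simp

lemma unitBallVol_eq (d : ℕ) :
    unitBallVol d = (volume (Metric.closedBall (0 : E d) 1)).toReal := by
  unfold unitBallVol
  rw [← (PiLp.volume_preserving_toLp (Fin d)).measure_preimage
    measurableSet_closedBall.nullMeasurableSet]
  congr 2
  ext v
  simp [e2norm_eq]

lemma ball_integral {d : ℕ} {s : ℝ} (hs : 0 < s) :
    Integrable (fun v : E d => if ‖v‖ ≤ s then (1 : ℝ) else 0) ∧
    ∫ v : E d, (if ‖v‖ ≤ s then (1 : ℝ) else 0) = unitBallVol d * s ^ d := by
  have e : (fun v : E d => if ‖v‖ ≤ s then (1 : ℝ) else 0) =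
      (Metric.closedBall (0 : E d) s).indicator (fun _ => (1 : ℝ)) := by
    funext v
    by_cases h : ‖v‖ ≤ s
    · rw [if_pos h, Set.indicator_of_mem (by simpa using h)]
    · rw [if_neg h, Set.indicator_of_notMem (by simpa using h)]
  rw [e]
  constructor
  · rw [integrable_indicator_iff measurableSet_closedBall]
    exact (continuous_const.continuousOn).integrableOn_compact (isCompact_closedBall _ _)
  · rw [integral_indicator measurableSet_closedBall, setIntegral_const, Measure.real,
      Measure.addHaar_closedBall' _ _ hs.le, ENNReal.toReal_mul,
      ENNReal.toReal_ofReal (by positivity), unitBallVol_eq]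
    simp
    ring

noncomputable def P {d : ℕ} (x : ℕ → (Fin d → ℝ)) (h : ℝ → ℝ) (N : ℕ) : ℝ :=
  (∑ p ∈ (Finset.Icc 1 N ×ˢ Finset.Icc 1 N).filter (fun p => p.1 ≠ p.2),
    h ((N : ℝ) ^ ((1 : ℝ) / d) * torusDist (x p.1) (x p.2))) / N

def Good {d : ℕ} (x : ℕ → (Fin d → ℝ)) (h : ℝ → ℝ) : Prop :=
  Integrable (fun v : E d => h ‖v‖) ∧
    Tendsto (P x h) atTop (nhds (∫ v : E d, h ‖v‖))

lemma Good.add {d : ℕ} {x : ℕ → (Fin d → ℝ)} {h k : ℝ → ℝ} (hh : Good x h) (hk : Good x k) :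
    Good x (fun t => h t + k t) := by
  refine ⟨hh.1.add hk.1, ?_⟩
  rw [integral_add hh.1 hk.1]
  refine (hh.2.add hk.2).congr fun N => ?_
  simp only [P, Finset.sum_add_distrib, add_div]

lemma Good.smul {d : ℕ} {x : ℕ → (Fin d → ℝ)} {h : ℝ → ℝ} (hh : Good x h) (c : ℝ) :
    Good x (fun t => c * h t) := by
  refine ⟨hh.1.const_mul c, ?_⟩
  rw [integral_const_mul]
  refine (hh.2.const_mul c).congr fun N => ?_
  simp only [P, ← Finset.mul_sum, mul_div_assoc]

lemma Good.zero {d : ℕ} (x : ℕ → (Fin d → ℝ)) : Good x (fun _ => 0) := by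
  refine ⟨integrable_zero _ _ _, ?_⟩
  simp only [integral_zero]
  refine tendsto_const_nhds.congr fun N => ?_
  simp [P]

lemma Good.sum {d : ℕ} {x : ℕ → (Fin d → ℝ)} {h : ℕ → ℝ → ℝ} (M : ℕ) (hh : ∀ j, Good x (h j)) :
    Good x (fun t => ∑ j ∈ Finset.range M, h j t) := by
  induction M with
  | zero => simpa using Good.zero x
  | succ M ih =>
    simp only [Finset.sum_range_succ]
    exact ih.add (hh M)

lemma good_step {d : ℕ} (x : ℕ → (Fin d → ℝ))
    (hppc : ∀ s : ℝ, 0 < s →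
      Tendsto (fun N : ℕ =>
        (((Finset.Icc 1 N ×ˢ Finset.Icc 1 N).filter
          (fun p => p.1 ≠ p.2 ∧
            torusDist (x p.1) (x p.2) ≤ s * (N : ℝ) ^ (-(1 : ℝ) / (d : ℝ)))).card : ℝ) / N)
        atTop (nhds (unitBallVol d * s ^ d))) {s : ℝ} (hs : 0 < s) :
    Good x (fun t => if t ≤ s then 1 else 0) := by
  refine ⟨(ball_integral hs).1, ?_⟩
  rw [(ball_integral hs).2]
  refine (hppc s hs).congr' ?_
  filter_upwards [eventually_gt_atTop 0] with N hN
  have hN' : (0 : ℝ) < N := by exact_mod_cast hN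
  unfold P
  congr 1
  rw [Finset.sum_ite, Finset.sum_const_zero, add_zero, Finset.sum_const, Finset.filter_filter]
  simp only [nsmul_eq_mul, mul_one]
  congr 2
  ext p
  have hL : (0 : ℝ) < (N : ℝ) ^ ((1 : ℝ) / d) := by positivity
  have : torusDist (x p.1) (x p.2) ≤ s * (N : ℝ) ^ (-(1 : ℝ) / (d : ℝ)) ↔
      (N : ℝ) ^ ((1 : ℝ) / d) * torusDist (x p.1) (x p.2) ≤ s := by
    rw [neg_div, Real.rpow_neg hN'.le, ← div_eq_mul_inv, le_div_iff₀ hL, mul_comm]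
  simp only [Finset.mem_filter, this]

/-- step function approximating `g` from above -/
noncomputable def stepf (g : ℝ → ℝ) (T ε : ℝ) (M : ℕ) (t : ℝ) : ℝ :=
  ε * (if t ≤ T then 1 else 0) + ∑ j ∈ Finset.range M,
    (g (j * (T / M)) - g (((j + 1 : ℕ) : ℝ) * (T / M))) *
      (if t ≤ ((j + 1 : ℕ) : ℝ) * (T / M) then 1 else 0)

lemma stepf_good {d : ℕ} {x : ℕ → (Fin d → ℝ)}
    (H : ∀ s : ℝ, 0 < s → Good x (fun t => if t ≤ s then 1 else 0))
    (g : ℝ → ℝ) {T : ℝ} (hT : 0 < T) (ε : ℝ) (M : ℕ) (hM : 0 < M) : Good x (stepf g T ε M) := by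
  have hM' : (0 : ℝ) < M := by exact_mod_cast hM
  unfold stepf
  refine ((H T hT).smul ε).add (Good.sum M fun j => (H _ ?_).smul _)
  positivity

lemma stepf_out (g : ℝ → ℝ) {T : ℝ} (hT : 0 < T) (ε : ℝ) (M : ℕ) (hM : 0 < M) {t : ℝ}
    (ht : T < t) : stepf g T ε M t = 0 := by
  have hM' : (0 : ℝ) < M := by exact_mod_cast hM
  unfold stepf
  rw [if_neg (by linarith), mul_zero, zero_add]
  refine Finset.sum_eq_zero fun j hj => ?_
  rw [if_neg, mul_zero]
  have hj : ((j + 1 : ℕ) : ℝ) ≤ M := by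
    have := Finset.mem_range.mp hj
    exact_mod_cast this
  have : ((j + 1 : ℕ) : ℝ) * (T / M) ≤ M * (T / M) := by gcongr
  have e : (M : ℝ) * (T / M) = T := by field_simp
  linarith

lemma stepf_in (g : ℝ → ℝ) {T : ℝ} (hT : 0 < T) (ε : ℝ) (M : ℕ) (hM : 0 < M)
    (hgT : g T = 0)
    {t : ℝ} (h0 : 0 ≤ t) (ht : t ≤ T) :
    ∃ s, |s - t| ≤ T / M ∧ stepf g T ε M t = ε + g s := by
  have hM' : (0 : ℝ) < M := by exact_mod_cast hM
  have hδ : 0 < T / M := by positivity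
  have e : (M : ℝ) * (T / M) = T := by field_simp
  set δ := T / M with hδdef
  let k := ⌈t / δ⌉₊ - 1
  have hk : ∀ j : ℕ, t ≤ ((j + 1 : ℕ) : ℝ) * δ ↔ k ≤ j := by
    intro j
    rw [← div_le_iff₀ hδ, ← Nat.ceil_le]
    omega
  have hkM : k ≤ M := by
    have : ⌈t / δ⌉₊ ≤ M := by
      rw [Nat.ceil_le, div_le_iff₀ hδ]; linarith
    omega
  refine ⟨k * δ, ?_, ?_⟩
  · have h1 := (hk k).2 le_rfl
    push_cast at h1
    have h2 : k * δ ≤ t := by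
      by_cases h : k = 0
      · rw [h]; simpa using h0
      · have := (hk (k - 1)).not.2 (by omega)
        rw [Nat.sub_add_cancel (by omega)] at this
        linarith
    rw [abs_le]; constructor <;> nlinarith
  · unfold stepf
    rw [if_pos ht, mul_one]
    congr 1
    simp only [← hδdef, hk, mul_ite, mul_one, mul_zero]
    rw [← Finset.sum_filter]
    have : (Finset.range M).filter (fun j => k ≤ j) = Finset.Ico k M := by
      ext j; simp; tauto
    rw [this]
    have h3 := Finset.sum_Ico_sub (f := fun j : ℕ => g (j * δ)) hkM
    have h4 : ∑ j ∈ Finset.Ico k M, (g (j * δ) - g (((j + 1 : ℕ) : ℝ) * δ)) =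
      - ∑ j ∈ Finset.Ico k M, (g (((j + 1 : ℕ) : ℝ) * δ) - g (j * δ)) := by
      rw [← Finset.sum_neg_distrib]
      exact Finset.sum_congr rfl fun j _ => by ring
    rw [h4, h3, e, hgT]
    ring

lemma torusDist_nonneg {d : ℕ} (x y : Fin d → ℝ) : 0 ≤ torusDist x y :=
  Real.iInf_nonneg fun _ => Real.sqrt_nonneg _

lemma pair_limit {d : ℕ} {x : ℕ → (Fin d → ℝ)}
    (H : ∀ s : ℝ, 0 < s → Good x (fun t => if t ≤ s then 1 else 0))
    (g : ℝ → ℝ) {T K : ℝ} (hT : 0 < T) (hK : 0 ≤ K) (hg : ∀ s t, |g s - g t| ≤ K * |s - t|)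
    (hgT : ∀ t, T ≤ t → g t = 0) (hQint : Integrable (fun v : E d => g ‖v‖))
    {η : ℝ} (hη : 0 < η) :
    ∀ᶠ N in atTop, P x g N ≤ (∫ v : E d, g ‖v‖) + η := by
  obtain ⟨ω, hω⟩ : ∃ ω, ω = ∫ v : E d, (if ‖v‖ ≤ T then (1 : ℝ) else 0) := ⟨_, rfl⟩
  have hω0 : 0 ≤ ω := by
    rw [hω]; exact integral_nonneg fun v => by positivity
  let ε := η / (4 * (ω + 1))
  have hε : 0 < ε := by positivity
  obtain ⟨M, hM⟩ := exists_nat_gt (K * T / ε)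
  have hM0 : (0 : ℝ) < M := lt_of_le_of_lt (by positivity) hM
  have hM1 : 0 < M := by exact_mod_cast hM0
  have hKM : K * (T / M) ≤ ε := by
    rw [div_lt_iff₀ hε] at hM
    rw [← mul_div_assoc, div_le_iff₀ hM0]; linarith
  have key : ∀ t, 0 ≤ t → g t ≤ stepf g T ε M t ∧
      stepf g T ε M t ≤ g t + 2 * ε * (if t ≤ T then 1 else 0) := by
    intro t ht
    by_cases h : t ≤ T
    · obtain ⟨s, hs, he⟩ := stepf_in g hT ε M hM1 (hgT T le_rfl) ht h
      have h1 := (hg s t).trans (mul_le_mul_of_nonneg_left hs hK)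
      rw [abs_le] at h1
      rw [if_pos h, he]
      constructor <;> linarith
    · push Not at h
      rw [stepf_out g hT ε M hM1 h, hgT t h.le, if_neg (by linarith)]
      simp
  have hgood := stepf_good H g hT ε M hM1
  have hle : ∫ v : E d, stepf g T ε M ‖v‖ ≤ (∫ v : E d, g ‖v‖) + 2 * ε * ω := by
    rw [hω, ← integral_const_mul, ← integral_add hQint ((H T hT).1.const_mul _)]
    exact integral_mono hgood.1 (hQint.add ((H T hT).1.const_mul _))
      fun v => (key _ (norm_nonneg v)).2
  have h5 : 2 * ε * ω < η := by
    have : η = ε * (4 * (ω + 1)) := by simp only [ε]; field_simp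
    rw [this]; nlinarith
  have h6 : ∫ v : E d, stepf g T ε M ‖v‖ < (∫ v : E d, g ‖v‖) + η := by linarith
  filter_upwards [hgood.2.eventually_lt_const h6] with N hN
  refine le_trans ?_ hN.le
  unfold P
  gcongr with p hp
  exact (key _ (mul_nonneg (by positivity) (torusDist_nonneg _ _))).1

lemma torusDist_eq {d : ℕ} (x y : Fin d → ℝ)
    (h : ∀ i, |Int.fract (x i) - Int.fract (y i)| < 1 / 2) :
    torusDist x y = e2norm (fun i => Int.fract (x i) - Int.fract (y i)) := by
  unfold torusDist
  apply le_antisymm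
  · refine (ciInf_le ⟨0, ?_⟩ (fun i => ⌊x i⌋ - ⌊y i⌋)).trans_eq ?_
    · rintro _ ⟨k, rfl⟩
      exact Real.sqrt_nonneg _
    · congr 1
      ext i
      simp only [Int.fract]
      push_cast
      ring
  · refine le_ciInf fun k => ?_
    unfold e2norm
    refine Real.sqrt_le_sqrt (Finset.sum_le_sum fun i _ => ?_)
    have e : x i - y i - (k i : ℝ) =
        (Int.fract (x i) - Int.fract (y i)) - ((k i - ⌊x i⌋ + ⌊y i⌋ : ℤ) : ℝ) := by
      simp only [Int.fract]; push_cast; ring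
    simp only [e]
    set u := Int.fract (x i) - Int.fract (y i)
    generalize (k i - ⌊x i⌋ + ⌊y i⌋ : ℤ) = j
    have hu := abs_lt.1 (h i)
    rcases lt_trichotomy j 0 with hj | hj | hj
    · have : (j : ℝ) ≤ -1 := by exact_mod_cast (by omega : j ≤ -1)
      nlinarith
    · simp [hj]
    · have : (1 : ℝ) ≤ j := by exact_mod_cast (by omega : 1 ≤ j)
      nlinarith

def box {d : ℕ} (α β : Fin d → ℝ) : Set (E d) := WithLp.ofLp ⁻¹' (Set.Icc α β)

lemma mem_box {d : ℕ} {α β : Fin d → ℝ} {u : E d} :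
    u ∈ box α β ↔ ∀ i, α i ≤ u i ∧ u i ≤ β i := by
  simp only [box, Set.mem_preimage, Set.mem_Icc, Pi.le_def]
  exact forall_and.symm

lemma box_compact {d : ℕ} (α β : Fin d → ℝ) : IsCompact (box α β) := by
  have : box α β = WithLp.toLp 2 '' (Set.Icc α β) := by
    ext u
    simp only [box, Set.mem_preimage, Set.mem_image]
    exact ⟨fun h => ⟨_, h, rfl⟩, by rintro ⟨v, hv, rfl⟩; exact hv⟩
  rw [this]
  exact isCompact_Icc.image (PiLp.continuous_toLp 2 _)

lemma box_vol {d : ℕ} (α β : Fin d → ℝ) :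
    volume.real (box α β) = ∏ i, max (β i - α i) 0 := by
  rw [Measure.real, box, (PiLp.volume_preserving_ofLp (Fin d)).measure_preimage
    measurableSet_Icc.nullMeasurableSet, Real.volume_Icc_pi, ENNReal.toReal_prod]
  simp only [ENNReal.toReal_ofReal']

noncomputable def F {d : ℕ} (R : ℝ) (s : Finset ℕ) (Z : ℕ → E d) (u : E d) : ℝ :=
  ∑ n ∈ s, phi R (u - Z n)

lemma F_cont {d : ℕ} (R : ℝ) (s : Finset ℕ) (Z : ℕ → E d) : Continuous (F R s Z) := by
  unfold F
  have := phi_cont (d := d) R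
  fun_prop

lemma phiZ_int {d : ℕ} {R : ℝ} (hR : 0 < R) (z : E d) : Integrable (fun u => phi R (u - z)) :=
  (phi_int hR).comp_sub_right z

lemma phiZ_integral {d : ℕ} (R : ℝ) (z : E d) : ∫ u, phi R (u - z) = lam d R :=
  integral_sub_right_eq_self (phi R) z

lemma F_int {d : ℕ} {R : ℝ} (hR : 0 < R) (s : Finset ℕ) (Z : ℕ → E d) : Integrable (F R s Z) :=
  integrable_finsetSum _ fun n _ => phiZ_int hR (Z n)

lemma F_integral {d : ℕ} {R : ℝ} (hR : 0 < R) (s : Finset ℕ) (Z : ℕ → E d) :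
    ∫ u, F R s Z u = s.card * lam d R := by
  unfold F
  rw [integral_finsetSum _ fun n _ => phiZ_int hR (Z n)]
  simp [phiZ_integral]

lemma G_shift {d : ℕ} {R : ℝ} (hR : 0 < R) (z w : E d) :
    Integrable (fun u => phi R (u - z) * phi R (u - w)) ∧
    ∫ u, phi R (u - z) * phi R (u - w) = G R (w - z) := by
  have e : (fun u => phi R (u - z) * phi R (u - w)) =
      fun u => (fun v => phi R v * phi R (v - (w - z))) (u - z) := by
    ext u
    simp only
    congr 2
    abel
  rw [e]
  exact ⟨(G_int hR (w - z)).comp_sub_right z,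
    integral_sub_right_eq_self (fun v => phi R v * phi R (v - (w - z))) z⟩

lemma F_sq {d : ℕ} {R : ℝ} (hR : 0 < R) (s : Finset ℕ) (Z : ℕ → E d) :
    Integrable (fun u => F R s Z u ^ 2) ∧
    ∫ u, F R s Z u ^ 2 = ∑ p ∈ s ×ˢ s, G R (Z p.2 - Z p.1) := by
  have e : (fun u => F R s Z u ^ 2) =
      fun u => ∑ p ∈ s ×ˢ s, phi R (u - Z p.1) * phi R (u - Z p.2) := by
    ext u
    rw [F, sq, Finset.sum_mul_sum, Finset.sum_product]
  rw [e]
  refine ⟨integrable_finsetSum _ fun p _ => (G_shift hR _ _).1, ?_⟩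
  rw [integral_finsetSum _ fun p _ => (G_shift hR _ _).1]
  exact Finset.sum_congr rfl fun p _ => (G_shift hR _ _).2

lemma var_bound {d : ℕ} {R : ℝ} (hR : 0 < R) (s : Finset ℕ) (Z : ℕ → E d) {Q S : Set (E d)}
    (hQ : IsCompact Q) (hS : IsCompact S) (hSQ : S ⊆ Q)
    (hsupp : ∀ n ∈ s, ∀ u, u ∉ Q → phi R (u - Z n) = 0) {t : ℝ} (ht : 0 < t) :
    |(∫ u in S, F R s Z u) - lam d R * volume.real S| ≤ t / 2 * volume.real Q +
      1 / (2 * t) * ((∫ u, F R s Z u ^ 2) - 2 * lam d R ^ 2 * s.card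
        + lam d R ^ 2 * volume.real Q) := by
  set l := lam d R with hl
  have hFc := F_cont R s Z
  have hF0 : ∀ u, u ∉ Q → F R s Z u = 0 := fun u hu =>
    Finset.sum_eq_zero fun n hn => hsupp n hn u hu
  have hQint : ∀ f : E d → ℝ, Continuous f → IntegrableOn f Q := fun f hf =>
    hf.continuousOn.integrableOn_compact hQ
  have hintS : ∀ f : E d → ℝ, Continuous f → IntegrableOn f S := fun f hf =>
    hf.continuousOn.integrableOn_compact hS
  have h1 : (∫ u in S, F R s Z u) - l * volume.real S = ∫ u in S, (F R s Z u - l) := by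
    rw [integral_sub (hintS _ hFc) (hintS _ continuous_const), setIntegral_const, smul_eq_mul]
    ring
  have h2 : ∫ u in Q, F R s Z u = s.card * l := by
    rw [setIntegral_eq_integral_of_forall_compl_eq_zero hF0, F_integral hR]
  have h3 : ∫ u in Q, F R s Z u ^ 2 = ∫ u, F R s Z u ^ 2 :=
    setIntegral_eq_integral_of_forall_compl_eq_zero fun u hu => by rw [hF0 u hu]; norm_num
  have h4 : ∫ u in Q, (t / 2 + 1 / (2 * t) * (F R s Z u - l) ^ 2) =
      t / 2 * volume.real Q + 1 / (2 * t) * ((∫ u, F R s Z u ^ 2) - 2 * l ^ 2 * s.card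
        + l ^ 2 * volume.real Q) := by
    obtain ⟨c, hc⟩ : ∃ c, c = t / 2 + 1 / (2 * t) * l ^ 2 := ⟨_, rfl⟩
    have e : (fun u => t / 2 + 1 / (2 * t) * (F R s Z u - l) ^ 2) = fun u =>
      c + (1 / (2 * t) * F R s Z u ^ 2
        + (- (1 / (2 * t)) * 2 * l) * F R s Z u) := by
      ext u; rw [hc]; ring
    rw [e, integral_add (hQint _ (by fun_prop)) (hQint _ (by fun_prop)),
      integral_add (hQint _ (by fun_prop)) (hQint _ (by fun_prop)), setIntegral_const, smul_eq_mul,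
      integral_const_mul, integral_const_mul, h2, h3, hc]
    ring
  rw [h1, ← h4]
  calc |∫ u in S, (F R s Z u - l)| ≤ ∫ u in S, |F R s Z u - l| := abs_integral_le_integral_abs
    _ ≤ ∫ u in S, (t / 2 + 1 / (2 * t) * (F R s Z u - l) ^ 2) := by
      refine setIntegral_mono (hintS _ (by fun_prop)) (hintS _ (by fun_prop)) fun u => ?_
      simp only
      rw [← sq_abs (F R s Z u - l)]
      generalize |F R s Z u - l| = y
      have : t / 2 + 1 / (2 * t) * y ^ 2 - y = 1 / (2 * t) * (t - y) ^ 2 := by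
        field_simp; ring
      have h5 : 0 ≤ 1 / (2 * t) * (t - y) ^ 2 := by positivity
      linarith
    _ ≤ _ := by
      refine setIntegral_mono_set (hQint _ (by fun_prop)) ?_ ?_
      · exact Eventually.of_forall fun u => by simp only [Pi.zero_apply]; positivity
      · exact hSQ.eventuallyLE

lemma F_lower {d : ℕ} {R : ℝ} (hR : 0 < R) (s A : Finset ℕ) (Z : ℕ → E d) {S : Set (E d)}
    (hA : A ⊆ s) (h : ∀ n ∈ A, ∀ u, u ∉ S → phi R (u - Z n) = 0) :
    A.card * lam d R ≤ ∫ u in S, F R s Z u := by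
  rw [← F_integral hR A Z, ← setIntegral_eq_integral_of_forall_compl_eq_zero (s := S)
    (f := F R A Z) (fun u hu => Finset.sum_eq_zero fun n hn => h n hn u hu)]
  refine setIntegral_mono (F_int hR _ _).integrableOn (F_int hR _ _).integrableOn fun u => ?_
  exact Finset.sum_le_sum_of_subset_of_nonneg hA fun _ _ _ => phi_nonneg _ _

lemma F_upper {d : ℕ} {R : ℝ} (hR : 0 < R) (s A : Finset ℕ) (Z : ℕ → E d) {S : Set (E d)}
    (hS : MeasurableSet S) (hA : A ⊆ s)
    (h : ∀ n ∈ s, n ∉ A → ∀ u, u ∈ S → phi R (u - Z n) = 0) :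
    ∫ u in S, F R s Z u ≤ A.card * lam d R := by
  rw [← F_integral hR A Z]
  refine le_trans ?_ (setIntegral_le_integral (s := S) (F_int hR A Z)
    (Eventually.of_forall fun u => Finset.sum_nonneg fun _ _ => phi_nonneg _ _))
  refine setIntegral_mono_on (F_int hR _ _).integrableOn (F_int hR _ _).integrableOn hS
    fun u hu => ?_
  exact (Finset.sum_subset hA fun n hn hnA => h n hn hnA u hu).ge

/-- the dilated reduced points -/
noncomputable def ZZ {d : ℕ} (x : ℕ → (Fin d → ℝ)) (L : ℝ) (n : ℕ) : E d :=
  L • (WithLp.toLp 2 (fun i => Int.fract (x n i)) : E d)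

lemma ZZ_apply {d : ℕ} (x : ℕ → (Fin d → ℝ)) (L : ℝ) (n : ℕ) (i : Fin d) :
    ZZ x L n i = L * Int.fract (x n i) := by
  simp [ZZ]

lemma coord_le {d : ℕ} (v : E d) (i : Fin d) : |v i| ≤ ‖v‖ := by
  simpa using PiLp.norm_apply_le v i

lemma phi_ne {d : ℕ} {R : ℝ} (hR : 0 < R) {u z : E d} (h : phi R (u - z) ≠ 0) (i : Fin d) :
    -R ≤ u i - z i ∧ u i - z i ≤ R := by
  have h1 : ‖u - z‖ < R := by
    by_contra hc
    exact h (phi_zero hR (not_lt.1 hc))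
  have := (coord_le (u - z) i).trans h1.le
  rw [abs_le] at this
  simpa using this

lemma G_le {d : ℕ} {R : ℝ} (hR : 0 < R) (x : ℕ → (Fin d → ℝ)) {L : ℝ} (hL : 4 * R ≤ L)
    (e : E d) (he : ‖e‖ = 1) (m n : ℕ) :
    G R (ZZ x L n - ZZ x L m) ≤ G R ((L * torusDist (x m) (x n)) • e) := by
  have hL0 : 0 < L := by linarith
  let w : E d := WithLp.toLp 2 (fun i => Int.fract (x m i) - Int.fract (x n i))
  have hw : ZZ x L n - ZZ x L m = -(L • w) := by
    ext i
    simp [ZZ, w]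
    ring
  by_cases h : ‖w‖ < 1 / 2
  · apply le_of_eq
    apply G_radial
    rw [torusDist_eq, e2norm_eq, hw, norm_neg, norm_smul, norm_smul, he, mul_one, norm_mul,
      norm_norm]
    intro i
    exact (coord_le w i).trans_lt h
  · rw [G_zero hR]
    · exact G_nonneg _ _
    · rw [hw, norm_neg, norm_smul, Real.norm_of_nonneg hL0.le]
      push Not at h
      nlinarith

lemma main_ineq {d : ℕ} {R : ℝ} (hR : 0 < R) (x : ℕ → (Fin d → ℝ)) {N : ℕ} (hN : 0 < N)
    {L : ℝ} (hLdef : L = (N : ℝ) ^ ((1 : ℝ) / d)) (hL : 4 * R ≤ L)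
    (e : E d) (he : ‖e‖ = 1) :
    ∫ u, F R (Finset.Icc 1 N) (ZZ x L) u ^ 2 ≤
      N * lam d R + N * P x (fun t => G R (t • e)) N := by
  have hN' : (0 : ℝ) < N := by exact_mod_cast hN
  rw [(F_sq hR _ _).2, ← Finset.sum_filter_add_sum_filter_not _ (fun p : ℕ × ℕ => p.1 = p.2)]
  refine add_le_add ?_ ?_
  · have : ∀ p ∈ (Finset.Icc 1 N ×ˢ Finset.Icc 1 N).filter (fun p : ℕ × ℕ => p.1 = p.2),
        G R (ZZ x L p.2 - ZZ x L p.1) ≤ lam d R := by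
      intro p hp
      rw [(Finset.mem_filter.1 hp).2, sub_self]
      exact G_zero_le hR
    refine (Finset.sum_le_card_nsmul _ _ _ this).trans_eq ?_
    rw [nsmul_eq_mul]
    congr 2
    have := Finset.diag_card (Finset.Icc 1 N)
    simp only [Nat.card_Icc, add_tsub_cancel_right] at this
    rw [← this]
    congr 1
    ext ⟨p, q⟩
    simp only [Finset.mem_filter, Finset.mem_product, Finset.mem_diag]
    grind
  · unfold P
    rw [mul_div_cancel₀ _ hN'.ne', ← hLdef]
    exact Finset.sum_le_sum fun p _ => G_le hR x hL e he _ _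

lemma arith {n l p p₁ p₂ c I₁ I₂ η : ℝ} (hn : 0 < n) (hl : 0 < l)
    (h1 : I₁ - l * (n * p₁) < n * l * (η / 2)) (h2 : -(n * l * (η / 2)) < I₂ - l * (n * p₂))
    (h3 : c * l ≤ I₁) (h4 : I₂ ≤ c * l) (h5 : p₁ < p + η / 2) (h6 : p - η / 2 < p₂) :
    |c / n - p| < η := by
  have hnl : 0 < n * l := by positivity
  have h7 := mul_lt_mul_of_pos_left h5 hnl
  have h8 := mul_lt_mul_of_pos_left h6 hnl
  have h9 : c * l < ((p + η) * n) * l := by linarith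
  have h10 : ((p - η) * n) * l < c * l := by linarith
  have h11 := lt_of_mul_lt_mul_right h9 hl.le
  have h12 := lt_of_mul_lt_mul_right h10 hl.le
  rw [← div_lt_iff₀ hn] at h11
  rw [← lt_div_iff₀ hn] at h12
  rw [abs_lt]
  constructor <;> linarith

lemma final {d : ℕ} (hd : 1 ≤ d) (x : ℕ → (Fin d → ℝ))
    (H : ∀ s : ℝ, 0 < s → Good x (fun t => if t ≤ s then 1 else 0))
    (a b : Fin d → ℝ) (ha : ∀ i, 0 ≤ a i) (hab : ∀ i, a i ≤ b i) (hb : ∀ i, b i ≤ 1)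
    {η : ℝ} (hη : 0 < η) :
    ∀ᶠ N : ℕ in atTop, |(((Finset.Icc 1 N).filter
        (fun n => ∀ i, a i ≤ Int.fract (x n i) ∧ Int.fract (x n i) ≤ b i)).card : ℝ) / N
        - ∏ i, (b i - a i)| < η := by
  obtain ⟨c, hc, hlam⟩ := lam_ge hd
  obtain ⟨R, hR1, hRc⟩ : ∃ R : ℝ, 1 ≤ R ∧ 16 / η ^ 2 ≤ c * R := by
    refine ⟨max 1 (16 / η ^ 2 / c), le_max_left _ _, ?_⟩
    rw [mul_comm, ← div_le_iff₀ hc]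
    exact le_max_right _ _
  have hR : 0 < R := by linarith
  set l := lam d R with hl
  have hl1 : 16 / η ^ 2 ≤ l := hRc.trans (hlam R hR1)
  have hl0 : 0 < l := lt_of_lt_of_le (by positivity) hl1
  let e : E d := EuclideanSpace.single ⟨0, hd⟩ 1
  have he : ‖e‖ = 1 := by simp [e]
  have hGe : ∀ v : E d, G R (‖v‖ • e) = G R v := fun v => by
    apply G_radial; rw [norm_smul, he]; simp
  have hpair := pair_limit H (fun t => G R (t • e)) (T := 2 * R) (K := l / R) (by positivity)
    (by positivity) (fun s t => by
      refine (G_lip hR _ _).trans_eq ?_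
      rw [← sub_smul, norm_smul, he, Real.norm_eq_abs, mul_one])
    (fun t ht => G_zero hR (by
      rw [norm_smul, he, mul_one]; exact ht.trans (le_abs_self t)))
    (by simp only [hGe]; exact G_integrable hR) hl0
  simp only [hGe, G_integral hR, ← hl] at hpair
  -- limits
  have hLlim : Tendsto (fun N : ℕ => (N : ℝ) ^ ((1 : ℝ) / d)) atTop atTop :=
    (tendsto_rpow_atTop (by positivity)).comp tendsto_natCast_atTop_atTop
  have hrlim : Tendsto (fun N : ℕ => 2 * R / (N : ℝ) ^ ((1 : ℝ) / d)) atTop (nhds 0) :=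
    hLlim.const_div_atTop _
  have hcomp : ∀ f : ℝ → ℝ, Continuous f →
      Tendsto (fun N : ℕ => f (2 * R / (N : ℝ) ^ ((1 : ℝ) / d))) atTop (nhds (f 0)) :=
    fun f hf => (hf.tendsto 0).comp hrlim
  let t := l * η / 4
  have ht : 0 < t := by positivity
  let err : ℝ → ℝ := fun r => t * (1 + r) ^ d / (2 * l) +
    1 / (2 * t * l) * (2 * l + l ^ 2 * ((1 + r) ^ d - 1))
  have herr : ∀ᶠ N : ℕ in atTop, err (2 * R / (N : ℝ) ^ ((1 : ℝ) / d)) < η / 2 := by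
    refine (hcomp err (by fun_prop)).eventually_lt_const ?_
    simp only [err, add_zero, one_pow, sub_self, mul_zero, mul_one, t]
    have h1 : l * η / 4 / (2 * l) = η / 8 := by field_simp; norm_num
    have h2 : 1 / (2 * (l * η / 4) * l) * (2 * l) = 4 / (l * η) := by field_simp
    have h3 : 4 / (l * η) ≤ η / 4 := by
      rw [div_le_iff₀ (by positivity)]
      rw [div_le_iff₀ (by positivity)] at hl1
      nlinarith
    rw [h1, h2]
    linarith
  have hprod0 : ∏ i, max (b i - a i) 0 = ∏ i, (b i - a i) :=
    Finset.prod_congr rfl fun i _ => max_eq_left (by linarith [hab i])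
  have hup : ∀ᶠ N : ℕ in atTop, ∏ i, max (b i - a i + 2 * R / (N : ℝ) ^ ((1 : ℝ) / d)) 0 <
      ∏ i, (b i - a i) + η / 2 := by
    refine (hcomp (fun r => ∏ i, max (b i - a i + r) 0) (by fun_prop)).eventually_lt_const ?_
    simp only [add_zero, hprod0]
    linarith
  have hlo : ∀ᶠ N : ℕ in atTop, ∏ i, (b i - a i) - η / 2 <
      ∏ i, max (b i - a i - 2 * R / (N : ℝ) ^ ((1 : ℝ) / d)) 0 := by
    refine (hcomp (fun r => ∏ i, max (b i - a i - r) 0) (by fun_prop)).eventually_const_lt ?_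
    simp only [sub_zero, hprod0]
    linarith
  filter_upwards [hpair, herr, hup, hlo, eventually_gt_atTop 0,
    hLlim.eventually_ge_atTop (4 * R)] with N hpair herr hup hlo hN hL4
  have hN' : (0 : ℝ) < N := by exact_mod_cast hN
  obtain ⟨L, hLdef⟩ : ∃ L, L = (N : ℝ) ^ ((1 : ℝ) / d) := ⟨_, rfl⟩
  rw [← hLdef] at herr hup hlo hL4
  have hL0 : 0 < L := by linarith
  have hLd : L ^ d = N := by
    rw [hLdef, ← Real.rpow_natCast, ← Real.rpow_mul hN'.le, one_div_mul_cancel, Real.rpow_one]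
    have : (0 : ℝ) < d := by exact_mod_cast hd
    exact this.ne'
  have hmain := main_ineq hR x hN hLdef hL4 e he
  have hsq : ∫ u, F R (Finset.Icc 1 N) (ZZ x L) u ^ 2 ≤ N * l + N * (l ^ 2 + l) :=
    hmain.trans (by gcongr)
  have hscale : ∀ y : Fin d → ℝ, ∏ i, max (L * y i) 0 = N * ∏ i, max (y i) 0 := by
    intro y
    rw [← hLd]
    have : ∀ i, max (L * y i) 0 = L * max (y i) 0 := fun i => by
      rw [mul_max_of_nonneg _ _ hL0.le, mul_zero]
    simp only [this, Finset.prod_mul_distrib, Finset.prod_const, Finset.card_univ,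
      Fintype.card_fin]
  let Q : Set (E d) := box (fun _ => -R) (fun _ => L + R)
  let S₁ : Set (E d) := box (fun i => L * a i - R) (fun i => L * b i + R)
  let S₂ : Set (E d) := box (fun i => L * a i + R) (fun i => L * b i - R)
  have hQv : volume.real Q = N * (1 + 2 * R / L) ^ d := by
    have : ∀ i : Fin d, max (L + R - -R) 0 = max (L * (1 + 2 * R / L)) 0 := fun i => by
      congr 1; field_simp; ring
    rw [box_vol, Finset.prod_congr rfl (fun i _ => this i), hscale (fun _ => 1 + 2 * R / L),
      Finset.prod_const, max_eq_left (by positivity)]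
    simp
  have hS₁v : volume.real S₁ = N * ∏ i, max (b i - a i + 2 * R / L) 0 := by
    have : ∀ i : Fin d, max (L * b i + R - (L * a i - R)) 0 =
        max (L * (b i - a i + 2 * R / L)) 0 := fun i => by
      congr 1; field_simp; ring
    rw [box_vol, Finset.prod_congr rfl (fun i _ => this i),
      hscale (fun i => b i - a i + 2 * R / L)]
  have hS₂v : volume.real S₂ = N * ∏ i, max (b i - a i - 2 * R / L) 0 := by
    have : ∀ i : Fin d, max (L * b i - R - (L * a i + R)) 0 =
        max (L * (b i - a i - 2 * R / L)) 0 := fun i => by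
      congr 1; field_simp; ring
    rw [box_vol, Finset.prod_congr rfl (fun i _ => this i),
      hscale (fun i => b i - a i - 2 * R / L)]
  have hLa : ∀ i, 0 ≤ L * a i := fun i => mul_nonneg hL0.le (ha i)
  have hLb : ∀ i, L * b i ≤ L := fun i => mul_le_of_le_one_right hL0.le (hb i)
  have hS₁Q : S₁ ⊆ Q := fun u hu => mem_box.2 fun i => by
    have := mem_box.1 hu i
    have := hLa i
    have := hLb i
    constructor <;> linarith
  have hS₂Q : S₂ ⊆ Q := fun u hu => mem_box.2 fun i => by
    have := mem_box.1 hu i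
    have := hLa i
    have := hLb i
    constructor <;> linarith
  have hsupp : ∀ n ∈ Finset.Icc 1 N, ∀ u, u ∉ Q → phi R (u - ZZ x L n) = 0 := by
    intro n _ u hu
    by_contra hne
    refine hu (mem_box.2 fun i => ?_)
    have h1 := phi_ne hR hne i
    rw [ZZ_apply] at h1
    have h2 : 0 ≤ L * Int.fract (x n i) := mul_nonneg hL0.le (Int.fract_nonneg _)
    have h3 : L * Int.fract (x n i) ≤ L := mul_le_of_le_one_right hL0.le (Int.fract_lt_one _).le
    constructor <;> linarith
  set A := (Finset.Icc 1 N).filter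
        (fun n => ∀ i, a i ≤ Int.fract (x n i) ∧ Int.fract (x n i) ≤ b i) with hA
  have hbound : ∀ S : Set (E d), IsCompact S → S ⊆ Q →
      |(∫ u in S, F R (Finset.Icc 1 N) (ZZ x L) u) - l * volume.real S| < N * l * (η / 2) := by
    intro S hS hSQ
    have h1 := var_bound hR (Finset.Icc 1 N) (ZZ x L) (box_compact _ _ : IsCompact Q) hS hSQ hsupp ht
    refine h1.trans_lt ?_
    have h2 : N * l * err (2 * R / L) < N * l * (η / 2) := by gcongr
    refine lt_of_le_of_lt ?_ h2
    have h3 : N * l * err (2 * R / L) = t / 2 * volume.real Q + 1 / (2 * t) *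
        ((N * l + N * (l ^ 2 + l)) - 2 * l ^ 2 * (N : ℝ) + l ^ 2 * volume.real Q) := by
      rw [hQv]
      simp only [err]
      field_simp
      ring
    rw [h3, Nat.card_Icc, add_tsub_cancel_right]
    gcongr
  have hb1 := abs_lt.1 (hbound S₁ (box_compact _ _) hS₁Q)
  have hb2 := abs_lt.1 (hbound S₂ (box_compact _ _) hS₂Q)
  have hlow := F_lower hR (Finset.Icc 1 N) A (ZZ x L) (S := S₁) (Finset.filter_subset _ _) (by
    intro n hn u hu
    by_contra hne
    refine hu (mem_box.2 fun i => ?_)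
    have h1 := phi_ne hR hne i
    rw [ZZ_apply] at h1
    have h2 := (Finset.mem_filter.1 hn).2 i
    have h3 := mul_le_mul_of_nonneg_left h2.1 hL0.le
    have h4 := mul_le_mul_of_nonneg_left h2.2 hL0.le
    constructor <;> linarith)
  have hupp := F_upper hR (Finset.Icc 1 N) A (ZZ x L) (S := S₂)
    (box_compact _ _).isClosed.measurableSet (Finset.filter_subset _ _) (by
    intro n hn hnA u hu
    by_contra hne
    refine hnA (Finset.mem_filter.2 ⟨hn, fun i => ?_⟩)
    have h1 := phi_ne hR hne i
    rw [ZZ_apply] at h1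
    have h2 := mem_box.1 hu i
    constructor <;> refine le_of_mul_le_mul_left ?_ hL0 <;> linarith)
  rw [hS₁v] at hb1
  rw [hS₂v] at hb2
  exact arith hN' hl0 hb1.2 hb2.1 hlow hupp hup hlo

end PPC

/-- If a sequence in 𝕋^d has Poissonian pair correlation with respect to
the Euclidean torus distance (for all s > 0), then it is uniformly distributed:
the proportion of points (reduced mod 1) falling in any box ∏ [aᵢ, bᵢ] ⊆ [0,1]^d
converges to the volume of the box. -/
theorem stmt0 (d : ℕ) (hd : 1 ≤ d) (x : ℕ → (Fin d → ℝ))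
    (hppc : ∀ s : ℝ, 0 < s →
      Tendsto (fun N : ℕ =>
        (((Finset.Icc 1 N ×ˢ Finset.Icc 1 N).filter
          (fun p => p.1 ≠ p.2 ∧
            torusDist (x p.1) (x p.2) ≤ s * (N : ℝ) ^ (-(1 : ℝ) / (d : ℝ)))).card : ℝ) / N)
        atTop (nhds (unitBallVol d * s ^ d)))
    (a b : Fin d → ℝ) (ha : ∀ i, 0 ≤ a i) (hab : ∀ i, a i ≤ b i) (hb : ∀ i, b i ≤ 1) :
    Tendsto (fun N : ℕ =>
      (((Finset.Icc 1 N).filter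
        (fun n => ∀ i, a i ≤ Int.fract (x n i) ∧ Int.fract (x n i) ≤ b i)).card : ℝ) / N)
      atTop (nhds (∏ i, (b i - a i))) := by
  rw [Metric.tendsto_nhds]
  intro η hη
  filter_upwards [PPC.final hd x (fun s hs => PPC.good_step x hppc hs) a b ha hab hb hη] with N hN
  rw [Real.dist_eq]
  exact hN
end

section
/- Let (x_n)_{n≥1} be a sequence in [0,1)^d and suppose that for every s > 0, lim_{N→∞} (1/N)·#{(m,n) : 1 ≤ m ≠ n ≤ N, dist_∞(x_m, x_n) ≤ s·N^{-1/d}} = (2s)^d, where dist_∞(x,y) = max_{1≤i≤d} ‖x_i − y_i‖ and ‖·‖ denotes the distance to the nearest integer. Then (x_n) is uniformly distributed in [0,1)^d, i.e. for every box B = ∏_{i=1}^d [a_i, b_i) ⊆ [0,1)^d, lim_{N→∞} (1/N)·#{1 ≤ n ≤ N : x_n ∈ B} = ∏_{i=1}^d (b_i − a_i). -/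
open Filter

/-- Distance from a real number to the nearest integer. -/
noncomputable def nint (x : ℝ) : ℝ := |x - round x|

/-- The ℓ^∞ torus distance on [0,1)^d: max over coordinates of the distance
to the nearest integer of the coordinate difference. -/
noncomputable def torusDistSup {d : ℕ} (x y : Fin d → ℝ) : ℝ :=
  ⨆ i : Fin d, nint (x i - y i)

open Finset in
lemma card_pairs_eq {β γ : Type*} [DecidableEq β] [DecidableEq γ] (I : Finset ℕ) (f : ℕ → β) (g : ℕ → γ)
    (T : Finset β) (G : Finset γ) (hf : ∀ n ∈ I, f n ∈ T) (hg : ∀ n ∈ I, g n ∈ G)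
    (A : γ → γ → Prop) [DecidableRel A] :
    (((I ×ˢ I).filter (fun m => f m.1 = f m.2 ∧ A (g m.1) (g m.2))).card : ℝ) =
    ∑ Q ∈ T, ∑ c ∈ (G ×ˢ G).filter (fun c => A c.1 c.2),
      ((I.filter (fun n => f n = Q ∧ g n = c.1)).card : ℝ) *
      ((I.filter (fun n => f n = Q ∧ g n = c.2)).card : ℝ) := by
  have := Finset.card_eq_sum_card_fiberwise
    (s := (I ×ˢ I).filter (fun m => f m.1 = f m.2 ∧ A (g m.1) (g m.2)))
    (t := T ×ˢ ((G ×ˢ G).filter (fun c => A c.1 c.2)))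
    (f := fun m => (f m.1, (g m.1, g m.2))) (by
      intro m hm
      simp only [Finset.coe_filter, Finset.mem_product, Set.mem_ofPred_eq] at hm
      simp only [Finset.mem_coe, Finset.mem_product, Finset.mem_filter]
      exact ⟨hf _ hm.1.1, ⟨hg _ hm.1.1, hg _ hm.1.2⟩, hm.2.2⟩)
  rw [this, Finset.sum_product]
  push_cast
  refine Finset.sum_congr rfl fun Q hQ => Finset.sum_congr rfl fun c hc => ?_
  rw [← Nat.cast_mul, ← Finset.card_product]
  congr 2
  ext ⟨m, n⟩
  obtain ⟨c1, c2⟩ := c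
  simp only [Finset.mem_filter, Finset.mem_product, Prod.mk.injEq] at hc ⊢
  constructor
  · rintro ⟨⟨⟨hm, hn⟩, h1, h2⟩, h3, h4, h5⟩
    exact ⟨⟨hm, h3, h4⟩, hn, h1 ▸ h3, h5⟩
  · rintro ⟨⟨hm, h3, h4⟩, hn, h6, h5⟩
    exact ⟨⟨⟨hm, hn⟩, h3.trans h6.symm, by rw [h4, h5]; exact hc.2⟩, h3, h4, h5⟩

open Finset in
lemma card_pairs_eq_sq {β : Type*} [DecidableEq β] (I : Finset ℕ) (f : ℕ → β)
    (T : Finset β) (hf : ∀ n ∈ I, f n ∈ T) :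
    (((I ×ˢ I).filter (fun m => f m.1 = f m.2)).card : ℝ) =
    ∑ Q ∈ T, ((I.filter (fun n => f n = Q)).card : ℝ) ^ 2 := by
  have := card_pairs_eq I f (fun _ => ()) T {()} hf (by simp) (fun _ _ => True)
  simpa [Finset.sum_filter, sq, Finset.sum_product] using this

/-- index grid -/
def grid (d L : ℕ) : Finset (Fin d → ℕ) := Fintype.piFinset (fun _ => Finset.range L)

lemma card_grid (d L : ℕ) : (grid d L).card = L ^ d := by simp [grid]

/-- adjacency of cells -/
def adj {d : ℕ} (p : ℕ) (c c' : Fin d → ℕ) : Prop := ∀ i, c i ≤ c' i + p ∧ c' i ≤ c i + p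

instance {d p : ℕ} : DecidableRel (adj (d := d) p) := fun _ _ => by unfold adj; infer_instance

lemma deg_le {d q p : ℕ} (c : Fin d → ℕ) :
    ((grid d q).filter (fun c' => adj p c c')).card ≤ (2 * p + 1) ^ d := by
  have : (grid d q).filter (fun c' => adj p c c') ⊆
      Fintype.piFinset (fun i => Finset.Icc (c i - p) (c i + p)) := by
    intro c' h
    simp only [Finset.mem_filter, Fintype.mem_piFinset, Finset.mem_Icc] at h ⊢
    unfold adj at h
    intro i
    have := h.2 i
    omega
  refine (Finset.card_le_card this).trans ?_
  rw [Fintype.card_piFinset]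
  refine (Finset.prod_le_pow_card _ _ (2 * p + 1) fun i _ => ?_).trans (by simp)
  simp; omega

lemma pairs_ge {d q p : ℕ} (hq : 2 * p ≤ q) :
    ((q - 2 * p) ^ d * (2 * p + 1) ^ d) ≤
    ((grid d q ×ˢ grid d q).filter (fun c => adj p c.1 c.2)).card := by
  rw [← card_grid, ← card_grid, ← Finset.card_product]
  refine Finset.card_le_card_of_injOn (fun c => (fun i => c.1 i + p, fun i => c.1 i + c.2 i)) ?_ ?_
  · rintro ⟨a, b⟩ h
    simp only [grid, Finset.coe_product, Set.mem_prod, Finset.mem_coe, Fintype.mem_piFinset,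
      Finset.mem_range, Finset.mem_filter, Finset.mem_product] at h ⊢
    unfold adj
    dsimp only
    refine ⟨⟨fun i => ?_, fun i => ?_⟩, fun i => ?_⟩ <;>
    · have h1 := h.1 i
      have h2 := h.2 i
      omega
  · rintro ⟨a, b⟩ _ ⟨a', b'⟩ _ h
    simp only [Prod.mk.injEq, funext_iff] at h ⊢
    refine ⟨fun i => ?_, fun i => ?_⟩ <;>
    · have h1 := h.1 i
      have h2 := h.2 i
      omega

lemma block_ineq {d q p : ℕ} (hq0 : 0 < q) (hq : 2 * p ≤ q) (ν : (Fin d → ℕ) → ℝ) {δ : ℝ}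
    (hδ : 0 < δ) (hδ1 : δ < 1) :
    (1 - δ) * ((∑ c ∈ grid d q, ν c) / (q : ℝ) ^ d) ^ 2 *
        (((q : ℝ) - 2 * p) ^ d * (2 * p + 1) ^ d)
      - (1 / δ + 1) * (2 * p + 1) ^ d *
        (∑ c ∈ grid d q, ν c ^ 2 - (∑ c ∈ grid d q, ν c) ^ 2 / (q : ℝ) ^ d) ≤
    ∑ c ∈ (grid d q ×ˢ grid d q).filter (fun c => adj p c.1 c.2), ν c.1 * ν c.2 := by
  set G := grid d q with hG
  set u := (∑ c ∈ G, ν c) / (q : ℝ) ^ d with hu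
  have hqd : (0 : ℝ) < (q : ℝ) ^ d := by positivity
  have hsum : ∑ c ∈ G, ν c = u * (q : ℝ) ^ d := by rw [hu]; field_simp
  have hw : ∑ c ∈ G, ν c ^ 2 - (∑ c ∈ G, ν c) ^ 2 / (q : ℝ) ^ d = ∑ c ∈ G, (ν c - u) ^ 2 := by
    simp only [sub_sq, Finset.sum_add_distrib, Finset.sum_sub_distrib, Finset.sum_const, nsmul_eq_mul]
    rw [hG, card_grid, ← hG, ← Finset.sum_mul, ← Finset.mul_sum, hsum]
    push_cast
    field_simp
    ring
  rw [hw]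
  set P := (G ×ˢ G).filter (fun c => adj p c.1 c.2) with hP
  have h1 : ∀ c ∈ P, (1 - δ) * u ^ 2 - (1 / δ + 1) / 2 * ((ν c.1 - u) ^ 2 + (ν c.2 - u) ^ 2)
      ≤ ν c.1 * ν c.2 := by
    intro c _
    set w := ν c.1 - u with hw1
    set w' := ν c.2 - u with hw2
    have e1 : ν c.1 = u + w := by rw [hw1]; ring
    have e2 : ν c.2 = u + w' := by rw [hw2]; ring
    rw [e1, e2]
    have k1 : 0 ≤ (δ * u + (w + w') / 2) ^ 2 / δ := by positivity
    have k2 : (δ * u + (w + w') / 2) ^ 2 / δ = δ * u ^ 2 + u * (w + w') + (w + w') ^ 2 / (4 * δ) := by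
      field_simp; ring
    have k3 : 0 ≤ (w - w') ^ 2 / (4 * δ) := by positivity
    have k4 : (w - w') ^ 2 / (4 * δ) + (w + w') ^ 2 / (4 * δ) = (1 / δ) / 2 * (w ^ 2 + w' ^ 2) := by
      field_simp; ring
    nlinarith [sq_nonneg (w + w')]
  refine le_trans ?_ (Finset.sum_le_sum h1)
  rw [Finset.sum_sub_distrib, Finset.sum_const, nsmul_eq_mul, ← Finset.mul_sum,
    Finset.sum_add_distrib]
  have hcard : (((q : ℝ) - 2 * p) ^ d * (2 * p + 1) ^ d) ≤ P.card := by
    have := pairs_ge (d := d) hq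
    have h2 : (((q - 2 * p) ^ d * (2 * p + 1) ^ d : ℕ) : ℝ) ≤ P.card := by exact_mod_cast this
    push_cast [Nat.cast_sub hq] at h2
    exact h2
  have s1 : ∑ c ∈ P, (ν c.1 - u) ^ 2 ≤ (2 * p + 1) ^ d * ∑ c ∈ G, (ν c - u) ^ 2 := by
    rw [hP, Finset.sum_filter, Finset.sum_product, Finset.mul_sum]
    refine Finset.sum_le_sum fun c _ => ?_
    dsimp only
    rw [← Finset.sum_filter, Finset.sum_const, nsmul_eq_mul]
    refine mul_le_mul_of_nonneg_right ?_ (sq_nonneg _)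
    exact_mod_cast deg_le c
  have s2 : ∑ c ∈ P, (ν c.2 - u) ^ 2 ≤ (2 * p + 1) ^ d * ∑ c ∈ G, (ν c - u) ^ 2 := by
    rw [hP, Finset.sum_filter, Finset.sum_product_right, Finset.mul_sum]
    refine Finset.sum_le_sum fun c _ => ?_
    dsimp only
    rw [← Finset.sum_filter, Finset.sum_const, nsmul_eq_mul]
    refine mul_le_mul_of_nonneg_right ?_ (sq_nonneg _)
    have : (G.filter (fun c' => adj p c' c)) = G.filter (fun c' => adj p c c') := by
      ext c'; rw [Finset.mem_filter, Finset.mem_filter]; unfold adj; simp only [and_comm]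
    rw [this]
    exact_mod_cast deg_le c
  have k : 0 < (1 / δ + 1) / 2 := by positivity
  have := mul_le_mul_of_nonneg_left (add_le_add s1 s2) k.le
  have := mul_le_mul_of_nonneg_left hcard (mul_nonneg (sub_nonneg.2 hδ1.le) (sq_nonneg u))
  linarith

/-- cell index -/
noncomputable def cell {d : ℕ} (x : ℕ → (Fin d → ℝ)) (L n : ℕ) : Fin d → ℕ :=
  fun i => ⌊(L : ℝ) * x n i⌋₊

/-- number of pairs of points in the same cell -/
noncomputable def SP {d : ℕ} (x : ℕ → (Fin d → ℝ)) (N L : ℕ) : ℝ :=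
  (((Finset.Icc 1 N ×ˢ Finset.Icc 1 N).filter
    (fun m => cell x L m.1 = cell x L m.2)).card : ℝ)

/-- number of pairs (diagonal included) at distance at most `r` -/
noncomputable def PC {d : ℕ} (x : ℕ → (Fin d → ℝ)) (N : ℕ) (r : ℝ) : ℝ :=
  (((Finset.Icc 1 N ×ˢ Finset.Icc 1 N).filter
    (fun m => torusDistSup (x m.1) (x m.2) ≤ r)).card : ℝ)

/-- normalized energy -/
noncomputable def En {d : ℕ} (x : ℕ → (Fin d → ℝ)) (N L : ℕ) : ℝ :=
  (L : ℝ) ^ d * SP x N L / (N : ℝ) ^ 2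

lemma nint_le_abs (y : ℝ) : nint y ≤ |y| := by
  unfold nint
  simpa using round_le y 0

lemma torusDistSup_le {d : ℕ} {y z : Fin d → ℝ} {r : ℝ} (hr : 0 ≤ r) (h : ∀ i, |y i - z i| ≤ r) :
    torusDistSup y z ≤ r :=
  Real.iSup_le (fun i => (nint_le_abs _).trans (h i)) hr

lemma dist_of_floor {L p : ℕ} (hL : 0 < L) {y z : ℝ} (hy : 0 ≤ y) (hz : 0 ≤ z)
    (h1 : ⌊(L : ℝ) * y⌋₊ ≤ ⌊(L : ℝ) * z⌋₊ + p) (h2 : ⌊(L : ℝ) * z⌋₊ ≤ ⌊(L : ℝ) * y⌋₊ + p) :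
    |y - z| ≤ ((p : ℝ) + 1) / L := by
  have hL' : (0 : ℝ) < L := by exact_mod_cast hL
  have a1 := Nat.floor_le (mul_nonneg hL'.le hy)
  have a2 := Nat.floor_le (mul_nonneg hL'.le hz)
  have b1 := Nat.lt_floor_add_one ((L : ℝ) * y)
  have b2 := Nat.lt_floor_add_one ((L : ℝ) * z)
  have c1 : ((⌊(L : ℝ) * y⌋₊ : ℕ) : ℝ) ≤ ⌊(L : ℝ) * z⌋₊ + p := by exact_mod_cast h1
  have c2 : ((⌊(L : ℝ) * z⌋₊ : ℕ) : ℝ) ≤ ⌊(L : ℝ) * y⌋₊ + p := by exact_mod_cast h2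
  rw [le_div_iff₀ hL', ← abs_of_pos hL', ← abs_mul, abs_le]
  constructor <;> nlinarith

lemma cell_div {d : ℕ} (x : ℕ → (Fin d → ℝ)) (L q n : ℕ) (hq : 0 < q) (i : Fin d) :
    cell x (L * q) n i / q = cell x L n i := by
  unfold cell
  rw [← Nat.floor_div_natCast]
  congr 1
  have : (q : ℝ) ≠ 0 := by positivity
  push_cast
  field_simp

lemma cell_mem {d : ℕ} (x : ℕ → (Fin d → ℝ)) (hx : ∀ n i, x n i ∈ Set.Ico (0 : ℝ) 1) (L n : ℕ)
    (hL : 0 < L) : cell x L n ∈ grid d L := by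
  have hL' : (0 : ℝ) < L := by exact_mod_cast hL
  simp only [grid, Fintype.mem_piFinset, Finset.mem_range, cell]
  intro i
  rw [Nat.floor_lt (mul_nonneg hL'.le (hx n i).1)]
  nlinarith [(hx n i).2]

lemma SP_le_PC {d : ℕ} (x : ℕ → (Fin d → ℝ)) (hx : ∀ n i, x n i ∈ Set.Ico (0 : ℝ) 1) (N L : ℕ)
    (hL : 0 < L) : SP x N L ≤ PC x N (1 / L) := by
  unfold SP PC
  norm_cast
  refine Finset.card_le_card (Finset.monotone_filter_right _ fun m _ h => ?_)
  refine torusDistSup_le (by positivity) fun i => ?_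
  have := congrFun h i
  unfold cell at this
  have := dist_of_floor (p := 0) hL (hx m.1 i).1 (hx m.2 i).1 (by omega) (by omega)
  simpa using this

lemma coarse_fine {d : ℕ} (x : ℕ → (Fin d → ℝ)) (hx : ∀ n i, x n i ∈ Set.Ico (0 : ℝ) 1)
    (N L q p : ℕ) (hL : 0 < L) (hq : 0 < q) (hpq : 2 * p ≤ q) {δ : ℝ} (hδ : 0 < δ) (hδ1 : δ < 1) :
    SP x N L ≤ (q : ℝ) ^ d * SP x N (L * q) ∧
    (1 - δ) * (SP x N L / ((q : ℝ) ^ d) ^ 2) * (((q : ℝ) - 2 * p) ^ d * (2 * p + 1) ^ d)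
      - (1 / δ + 1) * (2 * p + 1) ^ d * (SP x N (L * q) - SP x N L / (q : ℝ) ^ d)
      ≤ PC x N (((p : ℝ) + 1) / ((L * q : ℕ) : ℝ)) := by
  set I := Finset.Icc 1 N with hI
  set g : ℕ → Fin d → ℕ := fun n i => cell x (L * q) n i % q with hg
  have hgm : ∀ n ∈ I, g n ∈ grid d q := by
    intro n _
    simp only [grid, Fintype.mem_piFinset, Finset.mem_range, hg]
    exact fun i => Nat.mod_lt _ hq
  have hfm : ∀ n ∈ I, cell x L n ∈ grid d L := fun n _ => cell_mem x hx L n hL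
  set ν : (Fin d → ℕ) → (Fin d → ℕ) → ℝ :=
    fun Q c => ((I.filter (fun n => cell x L n = Q ∧ g n = c)).card : ℝ) with hν
  have hνs : ∀ Q, ∑ c ∈ grid d q, ν Q c = ((I.filter (fun n => cell x L n = Q)).card : ℝ) := by
    intro Q
    have := Finset.card_eq_sum_card_fiberwise (s := I.filter (fun n => cell x L n = Q))
      (t := grid d q) (f := g) (by
        intro n hn
        exact hgm n (Finset.mem_filter.1 hn).1)
    rw [this]
    push_cast
    refine Finset.sum_congr rfl fun c _ => ?_
    rw [hν]
    dsimp only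
    rw [Finset.filter_filter]
  have hC : SP x N L = ∑ Q ∈ grid d L, (∑ c ∈ grid d q, ν Q c) ^ 2 := by
    unfold SP
    rw [card_pairs_eq_sq I (cell x L) (grid d L) hfm]
    simp only [hνs]
  have hsame : ∀ m n, cell x (L * q) m = cell x (L * q) n ↔ cell x L m = cell x L n ∧ g m = g n := by
    intro m n
    constructor
    · intro h
      refine ⟨funext fun i => ?_, funext fun i => ?_⟩
      · rw [← cell_div x L q m hq, ← cell_div x L q n hq, h]
      · simp only [hg, h]
    · rintro ⟨h1, h2⟩
      funext i
      rw [← Nat.div_add_mod (cell x (L * q) m i) q, ← Nat.div_add_mod (cell x (L * q) n i) q,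
        cell_div x L q m hq, cell_div x L q n hq, h1]
      have := congrFun h2 i
      simp only [hg] at this
      rw [this]
  have hF : SP x N (L * q) = ∑ Q ∈ grid d L, ∑ c ∈ grid d q, ν Q c ^ 2 := by
    unfold SP
    simp only [hsame]
    rw [card_pairs_eq I (cell x L) g (grid d L) (grid d q) hfm hgm (fun a b => a = b)]
    refine Finset.sum_congr rfl fun Q _ => ?_
    rw [Finset.sum_filter, Finset.sum_product]
    refine Finset.sum_congr rfl fun c hc => ?_
    dsimp only
    rw [Finset.sum_ite_eq, if_pos hc, sq]
  constructor
  · rw [hC, hF, Finset.mul_sum]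
    refine Finset.sum_le_sum fun Q _ => ?_
    have := sq_sum_le_card_mul_sum_sq (s := grid d q) (f := ν Q)
    rw [card_grid] at this
    exact_mod_cast this
  · have hP : ∑ Q ∈ grid d L, ∑ c ∈ (grid d q ×ˢ grid d q).filter (fun c => adj p c.1 c.2),
        ν Q c.1 * ν Q c.2 ≤ PC x N (((p : ℝ) + 1) / ((L * q : ℕ) : ℝ)) := by
      rw [← card_pairs_eq I (cell x L) g (grid d L) (grid d q) hfm hgm (fun a b => adj p a b)]
      unfold PC
      norm_cast
      refine Finset.card_le_card (Finset.monotone_filter_right _ fun m _ h => ?_)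
      refine torusDistSup_le (by positivity) fun i => ?_
      have h1 := congrFun h.1 i
      have h2 := h.2 i
      have e1 := Nat.div_add_mod (cell x (L * q) m.1 i) q
      have e2 := Nat.div_add_mod (cell x (L * q) m.2 i) q
      rw [cell_div x L q _ hq] at e1 e2
      simp only [hg] at h2
      rw [h1] at e1
      have := dist_of_floor (L := L * q) (p := p) (by positivity) (hx m.1 i).1 (hx m.2 i).1
        (by change cell x (L * q) m.1 i ≤ cell x (L * q) m.2 i + p; omega)
        (by change cell x (L * q) m.2 i ≤ cell x (L * q) m.1 i + p; omega)
      exact_mod_cast this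
    refine le_trans ?_ hP
    refine le_trans (le_of_eq ?_)
      (Finset.sum_le_sum fun Q _ => block_ineq hq hpq (ν Q) hδ hδ1)
    rw [hC, hF]
    simp only [div_pow, Finset.sum_sub_distrib, ← Finset.mul_sum, ← Finset.sum_mul,
      ← Finset.sum_div]

lemma En_mono {d : ℕ} (x : ℕ → (Fin d → ℝ)) (hx : ∀ n i, x n i ∈ Set.Ico (0 : ℝ) 1)
    (N L q : ℕ) (hL : 0 < L) (hq : 0 < q) : En x N L ≤ En x N (L * q) := by
  have := (coarse_fine x hx N L q 0 hL hq (by omega) (δ := 1 / 2) (by norm_num) (by norm_num)).1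
  unfold En
  refine div_le_div_of_nonneg_right ?_ (by positivity)
  push_cast
  rw [mul_pow, mul_assoc]
  gcongr

lemma En_step {d : ℕ} (x : ℕ → (Fin d → ℝ)) (hx : ∀ n i, x n i ∈ Set.Ico (0 : ℝ) 1)
    (N L q p : ℕ) (hN : 0 < N) (hL : 0 < L) (hq : 0 < q) (hpq : 2 * p ≤ q)
    {δ : ℝ} (hδ : 0 < δ) (hδ1 : δ < 1) :
    (1 - δ) * (((q : ℝ) - 2 * p) / q) ^ d * En x N L
      - (1 / δ + 1) * (En x N (L * q) - En x N L)
    ≤ (((L * q : ℕ) : ℝ) ^ d * PC x N (((p : ℝ) + 1) / ((L * q : ℕ) : ℝ)) / (N : ℝ) ^ 2)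
        / (2 * p + 1) ^ d := by
  have h := (coarse_fine x hx N L q p hL hq hpq hδ hδ1).2
  have hk : (0 : ℝ) < ((L * q : ℕ) : ℝ) ^ d / (N : ℝ) ^ 2 / (2 * p + 1) ^ d := by positivity
  have := mul_le_mul_of_nonneg_left h hk.le
  refine le_trans (le_of_eq ?_) (this.trans (le_of_eq ?_))
  · unfold En
    have h1 : (q : ℝ) ≠ 0 := by positivity
    have h2 : (N : ℝ) ≠ 0 := by positivity
    have h3 : ((2 : ℝ) * p + 1) ^ d ≠ 0 := by positivity
    push_cast
    rw [mul_pow, div_pow]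
    generalize (2 * (p : ℝ) + 1) ^ d = R at *
    have h4 : (q : ℝ) ^ d ≠ 0 := by positivity
    generalize (q : ℝ) ^ d = q' at *
    field_simp
  · ring

/-- The pair correlation hypothesis. -/
def PPC {d : ℕ} (x : ℕ → (Fin d → ℝ)) : Prop := ∀ s : ℝ, 0 < s →
      Tendsto (fun N : ℕ =>
        (((Finset.Icc 1 N ×ˢ Finset.Icc 1 N).filter
          (fun p => p.1 ≠ p.2 ∧
            torusDistSup (x p.1) (x p.2) ≤ s * (N : ℝ) ^ (-(1 : ℝ) / (d : ℝ)))).card : ℝ) / N)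
        atTop (nhds ((2 * s) ^ d))

/-- grid size -/
noncomputable def MM (d : ℕ) (S : ℝ) (N : ℕ) : ℕ := ⌈S⁻¹ * (N : ℝ) ^ ((d : ℝ)⁻¹)⌉₊

lemma root_atTop (d : ℕ) (hd : 1 ≤ d) :
    Tendsto (fun N : ℕ => (N : ℝ) ^ ((d : ℝ)⁻¹)) atTop atTop := by
  have : (0 : ℝ) < (d : ℝ)⁻¹ := by positivity
  exact (tendsto_rpow_atTop this).comp tendsto_natCast_atTop_atTop

lemma MM_atTop (d : ℕ) (hd : 1 ≤ d) (S : ℝ) (hS : 0 < S) : Tendsto (MM d S) atTop atTop := by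
  unfold MM
  refine tendsto_nat_ceil_atTop.comp ?_
  exact (root_atTop d hd).const_mul_atTop (by positivity)

lemma MM_lim (d : ℕ) (hd : 1 ≤ d) (S : ℝ) (hS : 0 < S) :
    Tendsto (fun N : ℕ => (MM d S N : ℝ) ^ d / N) atTop (nhds ((S⁻¹) ^ d)) := by
  have h := ((tendsto_nat_ceil_mul_div_atTop (R := ℝ) (a := S⁻¹) (by positivity)).comp
    (root_atTop d hd)).pow d
  refine h.congr fun N => ?_
  simp only [Function.comp, MM]
  rw [div_pow, Real.rpow_inv_natCast_pow (by positivity) (by omega)]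

lemma PC_bound {d : ℕ} (hd : 1 ≤ d) (x : ℕ → (Fin d → ℝ)) (hppc : PPC x)
    (S : ℝ) (hS : 0 < S) (t p : ℕ) (ht : 0 < t) {η : ℝ} (hη : 0 < η) :
    ∀ᶠ N : ℕ in atTop, ((MM d S N * t : ℕ) : ℝ) ^ d *
      PC x N (((p : ℝ) + 1) / ((MM d S N * t : ℕ) : ℝ)) / (N : ℝ) ^ 2
      ≤ ((t : ℝ) / S) ^ d + (2 * ((p : ℝ) + 1)) ^ d + η := by
  have ht' : (0 : ℝ) < t := by exact_mod_cast ht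
  set s : ℝ := ((p : ℝ) + 1) * S / t with hs
  have hs0 : 0 < s := by positivity
  have h1 := hppc s hs0
  have h2 := (MM_lim d hd S hS).mul_const ((t : ℝ) ^ d)
  have h3 := h2.mul (h1.const_add 1)
  have e : (S⁻¹) ^ d * (t : ℝ) ^ d * (1 + (2 * s) ^ d) = ((t : ℝ) / S) ^ d + (2 * ((p : ℝ) + 1)) ^ d := by
    have : (2 * ((p : ℝ) + 1)) = S⁻¹ * t * (2 * s) := by rw [hs]; field_simp
    rw [this, mul_pow _ (2 * s), div_eq_mul_inv, mul_comm (t : ℝ), ← mul_pow]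
    ring
  rw [e] at h3
  filter_upwards [h3.eventually (gt_mem_nhds (lt_add_of_pos_right _ hη)), eventually_gt_atTop 0]
    with N hN hN0
  refine le_trans ?_ hN.le
  have hN0' : (0 : ℝ) < N := by exact_mod_cast hN0
  have hpc : PC x N (((p : ℝ) + 1) / ((MM d S N * t : ℕ) : ℝ)) ≤
      N + (((Finset.Icc 1 N ×ˢ Finset.Icc 1 N).filter
          (fun p => p.1 ≠ p.2 ∧
            torusDistSup (x p.1) (x p.2) ≤ s * (N : ℝ) ^ (-(1 : ℝ) / (d : ℝ)))).card : ℝ) := by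
    have hr : ((p : ℝ) + 1) / ((MM d S N * t : ℕ) : ℝ) ≤ s * (N : ℝ) ^ (-(1 : ℝ) / (d : ℝ)) := by
      have hM : S⁻¹ * (N : ℝ) ^ ((d : ℝ)⁻¹) ≤ MM d S N := Nat.le_ceil _
      have hρ : (0 : ℝ) < (N : ℝ) ^ ((d : ℝ)⁻¹) := by positivity
      have : (N : ℝ) ^ (-(1 : ℝ) / (d : ℝ)) = ((N : ℝ) ^ ((d : ℝ)⁻¹))⁻¹ := by
        rw [neg_div, one_div, Real.rpow_neg hN0'.le]
      rw [this]
      have hM0 : (0 : ℝ) < S⁻¹ * (N : ℝ) ^ ((d : ℝ)⁻¹) := by positivity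
      calc ((p : ℝ) + 1) / ((MM d S N * t : ℕ) : ℝ)
          ≤ ((p : ℝ) + 1) / (S⁻¹ * (N : ℝ) ^ ((d : ℝ)⁻¹) * t) := by
            push_cast
            gcongr
        _ = _ := by rw [hs]; field_simp
    unfold PC
    have hsub : ((Finset.Icc 1 N ×ˢ Finset.Icc 1 N).filter
        (fun m => torusDistSup (x m.1) (x m.2) ≤ ((p : ℝ) + 1) / ((MM d S N * t : ℕ) : ℝ))) ⊆
        (Finset.Icc 1 N).diag ∪ ((Finset.Icc 1 N ×ˢ Finset.Icc 1 N).filter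
          (fun p => p.1 ≠ p.2 ∧
            torusDistSup (x p.1) (x p.2) ≤ s * (N : ℝ) ^ (-(1 : ℝ) / (d : ℝ)))) := by
      intro m hm
      rw [Finset.mem_filter] at hm
      rw [Finset.mem_union, Finset.mem_filter, Finset.mem_diag]
      by_cases h : m.1 = m.2
      · exact Or.inl ⟨(Finset.mem_product.1 hm.1).1, h⟩
      · exact Or.inr ⟨hm.1, h, hm.2.trans hr⟩
    have := (Finset.card_le_card hsub).trans (Finset.card_union_le _ _)
    rw [Finset.diag_card, Nat.card_Icc, Nat.add_sub_cancel] at this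
    exact_mod_cast this
  calc _ ≤ ((MM d S N * t : ℕ) : ℝ) ^ d * (N + (((Finset.Icc 1 N ×ˢ Finset.Icc 1 N).filter
          (fun p => p.1 ≠ p.2 ∧
            torusDistSup (x p.1) (x p.2) ≤ s * (N : ℝ) ^ (-(1 : ℝ) / (d : ℝ)))).card : ℝ)) / (N : ℝ) ^ 2 := by
        gcongr
    _ = _ := by
        push_cast
        rw [mul_pow]
        field_simp

/-- the final bound constant -/
noncomputable def KK (d n : ℕ) : ℝ :=
  ((2 + (2 * ((n : ℝ) + 1)) ^ d) / (2 * n + 1) ^ d + ((n : ℝ) + 1) * (2 + 2 ^ d) / n ^ 2) /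
    ((1 - 1 / (n : ℝ)) * (1 - 1 / (n : ℝ)) ^ d)

lemma KK_lim (d : ℕ) (hd : 1 ≤ d) : Tendsto (KK d) atTop (nhds 1) := by
  have h0 : Tendsto (fun n : ℕ => 1 / (n : ℝ)) atTop (nhds 0) := tendsto_one_div_atTop_nhds_zero_nat
  have hb : Tendsto (fun n : ℕ => 1 / (2 * (n : ℝ) + 1)) atTop (nhds 0) := by
    refine squeeze_zero' (Eventually.of_forall fun n => by positivity) ?_ h0
    filter_upwards [eventually_gt_atTop 0] with n hn
    have : (0 : ℝ) < n := by exact_mod_cast hn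
    gcongr
    linarith
  have h1 : Tendsto (fun n : ℕ => 2 * (1 / (2 * (n : ℝ) + 1)) ^ d + (1 + 1 / (2 * (n : ℝ) + 1)) ^ d
      + (2 + 2 ^ d) * (1 / (n : ℝ) + (1 / (n : ℝ)) ^ 2)) atTop
      (nhds (2 * 0 ^ d + (1 + 0) ^ d + (2 + 2 ^ d) * (0 + 0 ^ 2))) :=
    (((hb.pow d).const_mul 2).add ((hb.const_add 1).pow d)).add ((h0.add (h0.pow 2)).const_mul _)
  have h2 : Tendsto (fun n : ℕ => (1 - 1 / (n : ℝ)) * (1 - 1 / (n : ℝ)) ^ d) atTop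
      (nhds ((1 - 0) * (1 - 0) ^ d)) := (h0.const_sub 1).mul ((h0.const_sub 1).pow d)
  have h3 := h1.div h2 (by simp)
  have e : (2 * (0 : ℝ) ^ d + (1 + 0) ^ d + (2 + 2 ^ d) * (0 + 0 ^ 2)) / ((1 - 0) * (1 - 0) ^ d) = 1 := by
    rw [zero_pow (by omega)]; simp
  rw [e] at h3
  refine h3.congr' ?_
  filter_upwards [eventually_gt_atTop 0] with n hn
  have hn' : (0 : ℝ) < n := by exact_mod_cast hn
  simp only [Pi.div_apply, KK]
  congr 1
  have : 1 + 1 / (2 * (n : ℝ) + 1) = (2 * ((n : ℝ) + 1)) / (2 * n + 1) := by field_simp; ring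
  rw [this, div_pow, div_pow]
  field_simp
  ring

lemma En_nonneg {d : ℕ} (x : ℕ → (Fin d → ℝ)) (N L : ℕ) : 0 ≤ En x N L := by
  unfold En SP; positivity

lemma En_bound_n {d : ℕ} (hd : 1 ≤ d) (x : ℕ → (Fin d → ℝ))
    (hx : ∀ n i, x n i ∈ Set.Ico (0 : ℝ) 1) (hppc : PPC x) (n : ℕ) (hn : 2 ≤ n) :
    ∃ S : ℝ, 0 < S ∧ ∀ᶠ N : ℕ in atTop, En x N (MM d S N) ≤ KK d n := by
  have hn' : (2 : ℝ) ≤ n := by exact_mod_cast hn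
  set q : ℕ := 2 * n ^ 2 with hq
  have hq0 : 0 < q := by positivity
  set J : ℕ := n ^ 2 with hJ
  set S : ℝ := (q : ℝ) ^ J with hS
  have hS0 : 0 < S := by positivity
  refine ⟨S, hS0, ?_⟩
  have hfin : ∀ᶠ N : ℕ in atTop, ∀ j ∈ Finset.range J,
      ((MM d S N * q ^ (j + 1) : ℕ) : ℝ) ^ d *
      PC x N (((n : ℝ) + 1) / ((MM d S N * q ^ (j + 1) : ℕ) : ℝ)) / (N : ℝ) ^ 2
      ≤ (((q ^ (j + 1) : ℕ) : ℝ) / S) ^ d + (2 * ((n : ℝ) + 1)) ^ d + 1 := by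
    rw [Filter.eventually_all_finset]
    intro j _
    exact PC_bound hd x hppc S hS0 (q ^ (j + 1)) n (by positivity) one_pos
  have htop := PC_bound hd x hppc S hS0 (q ^ J) 0 (by positivity) one_pos
  filter_upwards [hfin, htop, eventually_gt_atTop 0, (MM_atTop d hd S hS0).eventually_gt_atTop 0]
    with N hN hNt hN0 hM
  set M := MM d S N with hMdef
  have hmono : ∀ j, En x N M ≤ En x N (M * q ^ j) := by
    intro j
    exact En_mono x hx N M (q ^ j) hM (by positivity)
  have hEJ : En x N (M * q ^ J) ≤ 2 + 2 ^ d := by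
    have h1 := SP_le_PC x hx N (M * q ^ J) (by positivity)
    have h2 : En x N (M * q ^ J) ≤ ((M * q ^ J : ℕ) : ℝ) ^ d *
      PC x N (1 / ((M * q ^ J : ℕ) : ℝ)) / (N : ℝ) ^ 2 := by
      unfold En
      gcongr
    simp only [Nat.cast_zero, zero_add] at hNt
    refine h2.trans (hNt.trans (le_of_eq ?_))
    rw [hS]
    push_cast
    rw [div_self (by positivity)]
    simp
    ring
  have hδ : (0 : ℝ) < 1 / n := by positivity
  have hδ1 : 1 / (n : ℝ) < 1 := by rw [div_lt_one (by positivity)]; linarith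
  set A := (1 - 1 / (n : ℝ)) * (1 - 1 / (n : ℝ)) ^ d with hA
  have hA0 : 0 < A := by
    have : 0 < 1 - 1 / (n : ℝ) := by linarith
    positivity
  set B := (2 + (2 * ((n : ℝ) + 1)) ^ d) / (2 * n + 1) ^ d with hB
  have hstep : ∀ j ∈ Finset.range J, A * En x N M ≤ B +
      ((n : ℝ) + 1) * (En x N (M * q ^ (j + 1)) - En x N (M * q ^ j)) := by
    intro j hj
    have h1 := En_step x hx N (M * q ^ j) q n hN0 (by positivity) hq0 (by rw [hq]; nlinarith) hδ hδ1
    have e1 : (M * q ^ j) * q = M * q ^ (j + 1) := by ring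
    rw [e1] at h1
    have e2 : ((q : ℝ) - 2 * n) / q = 1 - 1 / (n : ℝ) := by
      rw [hq, hJ]; push_cast; field_simp
    rw [e2, ← hA, one_div_one_div] at h1
    have h2 := hN j hj
    have h3 : (((q ^ (j + 1) : ℕ) : ℝ) / S) ^ d ≤ 1 := by
      refine pow_le_one₀ (by positivity) ?_
      rw [div_le_one hS0, hS]
      push_cast
      exact pow_le_pow_right₀ (by exact_mod_cast hq0) (Finset.mem_range.1 hj)
    have h4 : (((M * q ^ (j + 1) : ℕ) : ℝ) ^ d *
      PC x N (((n : ℝ) + 1) / ((M * q ^ (j + 1) : ℕ) : ℝ)) / (N : ℝ) ^ 2) / (2 * n + 1) ^ d ≤ B := by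
      rw [hB]
      gcongr
      linarith
    have h5 := mul_le_mul_of_nonneg_left (hmono j) hA0.le
    linarith
  have hsum := Finset.sum_le_sum hstep
  rw [Finset.sum_add_distrib, ← Finset.mul_sum (f := fun j => En x N (M * q ^ (j + 1)) - En x N (M * q ^ j)), Finset.sum_range_sub (fun j => En x N (M * q ^ j)),
    Finset.sum_const, Finset.sum_const, Finset.card_range, nsmul_eq_mul, nsmul_eq_mul] at hsum
  have hE0 := En_nonneg x N (M * q ^ 0)
  have hlast : (J : ℝ) * (A * En x N M) ≤ J * B + ((n : ℝ) + 1) * (2 + 2 ^ d) := by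
    refine hsum.trans ?_
    gcongr
    linarith
  have hJr : (J : ℝ) = (n : ℝ) ^ 2 := by rw [hJ]; push_cast; rfl
  rw [hJr] at hlast
  unfold KK
  rw [← hA, ← hB, le_div_iff₀ hA0]
  have hn2 : (0 : ℝ) < (n : ℝ) ^ 2 := by positivity
  have : B + ((n : ℝ) + 1) * (2 + 2 ^ d) / (n : ℝ) ^ 2
      = ((n : ℝ) ^ 2 * B + ((n : ℝ) + 1) * (2 + 2 ^ d)) / (n : ℝ) ^ 2 := by
    field_simp
  rw [this, le_div_iff₀ hn2]
  linarith

lemma En_bound {d : ℕ} (hd : 1 ≤ d) (x : ℕ → (Fin d → ℝ))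
    (hx : ∀ n i, x n i ∈ Set.Ico (0 : ℝ) 1) (hppc : PPC x) {ε : ℝ} (hε : 0 < ε) :
    ∃ M : ℕ → ℕ, Tendsto M atTop atTop ∧ ∀ᶠ N : ℕ in atTop, En x N (M N) ≤ 1 + ε := by
  obtain ⟨n, h1, h2⟩ := (((KK_lim d hd).eventually (gt_mem_nhds (lt_add_of_pos_right 1 hε))).and
    (eventually_ge_atTop 2)).exists
  obtain ⟨S, hS, h⟩ := En_bound_n hd x hx hppc n h2
  exact ⟨MM d S, MM_atTop d hd S hS, h.mono fun N hN => hN.trans h1.le⟩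

/-- Discrepancy over unions of cells. -/
lemma union_cells {d : ℕ} (x : ℕ → (Fin d → ℝ)) (hx : ∀ n i, x n i ∈ Set.Ico (0 : ℝ) 1)
    (N L : ℕ) (hN : 0 < N) (hL : 0 < L) {ε : ℝ} (hε : 0 ≤ ε) (hE : En x N L ≤ 1 + ε ^ 2)
    (T : Finset (Fin d → ℕ)) (hT : T ⊆ grid d L) :
    |(((Finset.Icc 1 N).filter (fun n => cell x L n ∈ T)).card : ℝ) / N - T.card / (L : ℝ) ^ d| ≤ ε := by
  set I := Finset.Icc 1 N with hI
  set ν : (Fin d → ℕ) → ℝ := fun c => ((I.filter (fun n => cell x L n = c)).card : ℝ) with hν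
  have hN' : (0 : ℝ) < N := by exact_mod_cast hN
  have hLd : (0 : ℝ) < (L : ℝ) ^ d := by positivity
  have key : ∀ T' : Finset (Fin d → ℕ),
      ((I.filter (fun n => cell x L n ∈ T')).card : ℝ) = ∑ c ∈ T', ν c := by
    intro T'
    rw [Finset.card_eq_sum_card_fiberwise (s := I.filter (fun n => cell x L n ∈ T'))
      (t := T') (f := cell x L) (fun n hn => (Finset.mem_filter.1 hn).2)]
    push_cast
    refine Finset.sum_congr rfl fun c hc => ?_
    rw [hν, Finset.filter_filter]
    dsimp only
    congr 2
    ext n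
    simp only [Finset.mem_filter]
    constructor
    · rintro ⟨h1, _, h3⟩; exact ⟨h1, h3⟩
    · rintro ⟨h1, h3⟩; exact ⟨h1, h3 ▸ hc, h3⟩
  have htot : ∑ c ∈ grid d L, ν c = N := by
    rw [← key, Finset.filter_true_of_mem (fun n _ => cell_mem x hx L n hL)]
    simp [hI]
  have hSP : SP x N L = ∑ c ∈ grid d L, ν c ^ 2 := by
    unfold SP
    rw [card_pairs_eq_sq I (cell x L) (grid d L) (fun n _ => cell_mem x hx L n hL)]
  set u : ℝ := N / (L : ℝ) ^ d with hu
  have hvar : ∑ c ∈ grid d L, (ν c - u) ^ 2 = SP x N L - (N : ℝ) ^ 2 / (L : ℝ) ^ d := by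
    simp only [sub_sq, Finset.sum_add_distrib, Finset.sum_sub_distrib, Finset.sum_const, nsmul_eq_mul]
    rw [card_grid, ← Finset.sum_mul, ← Finset.mul_sum, htot, ← hSP, hu]
    push_cast
    field_simp
    ring
  have hvar2 : ∑ c ∈ grid d L, (ν c - u) ^ 2 ≤ ε ^ 2 * (N : ℝ) ^ 2 / (L : ℝ) ^ d := by
    rw [hvar]
    unfold En at hE
    rw [div_le_iff₀ (by positivity)] at hE
    rw [le_div_iff₀ hLd, sub_mul, div_mul_cancel₀ _ hLd.ne']
    linarith
  have hcs := sq_sum_le_card_mul_sum_sq (s := T) (f := fun c => ν c - u)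
  have hTc : (T.card : ℝ) ≤ (L : ℝ) ^ d := by
    have := Finset.card_le_card hT
    rw [card_grid] at this
    exact_mod_cast this
  have hsub : ∑ c ∈ T, (ν c - u) ^ 2 ≤ ∑ c ∈ grid d L, (ν c - u) ^ 2 :=
    Finset.sum_le_sum_of_subset_of_nonneg hT (fun _ _ _ => sq_nonneg _)
  have hfin : (∑ c ∈ T, (ν c - u)) ^ 2 ≤ (ε * N) ^ 2 := by
    calc _ ≤ (T.card : ℝ) * ∑ c ∈ T, (ν c - u) ^ 2 := hcs
      _ ≤ (L : ℝ) ^ d * (ε ^ 2 * (N : ℝ) ^ 2 / (L : ℝ) ^ d) :=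
          mul_le_mul hTc (hsub.trans hvar2) (Finset.sum_nonneg fun _ _ => sq_nonneg _) hLd.le
      _ = _ := by field_simp
  have habs := abs_le_of_sq_le_sq hfin (by positivity)
  have e : (((I.filter (fun n => cell x L n ∈ T)).card : ℝ) / N - T.card / (L : ℝ) ^ d)
      = (∑ c ∈ T, (ν c - u)) / N := by
    rw [key, Finset.sum_sub_distrib, Finset.sum_const, nsmul_eq_mul, hu]
    field_simp
  rw [e, abs_div, abs_of_pos hN', div_le_iff₀ hN']
  exact habs

theorem stmt6 (d : ℕ) (hd : 1 ≤ d) (x : ℕ → (Fin d → ℝ))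
    (hx : ∀ n i, x n i ∈ Set.Ico (0 : ℝ) 1)
    (hppc : ∀ s : ℝ, 0 < s →
      Tendsto (fun N : ℕ =>
        (((Finset.Icc 1 N ×ˢ Finset.Icc 1 N).filter
          (fun p => p.1 ≠ p.2 ∧
            torusDistSup (x p.1) (x p.2) ≤ s * (N : ℝ) ^ (-(1 : ℝ) / (d : ℝ)))).card : ℝ) / N)
        atTop (nhds ((2 * s) ^ d)))
    (a b : Fin d → ℝ) (ha : ∀ i, 0 ≤ a i) (hab : ∀ i, a i < b i) (hb : ∀ i, b i ≤ 1) :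
    Tendsto (fun N : ℕ =>
      (((Finset.Icc 1 N).filter
        (fun n => ∀ i, a i ≤ x n i ∧ x n i < b i)).card : ℝ) / N)
      atTop (nhds (∏ i, (b i - a i))) := by
  rw [Metric.tendsto_nhds]
  intro ε hε
  have hε2 : 0 < ε / 2 := by positivity
  obtain ⟨M, hM, hE⟩ := En_bound hd x hx hppc (ε := (ε / 2) ^ 2) (by positivity)
  have hMr : Tendsto (fun N => (M N : ℝ)) atTop atTop := tendsto_natCast_atTop_atTop.comp hM
  have hfl : ∀ c : ℝ, 0 ≤ c → Tendsto (fun N => (⌊(M N : ℝ) * c⌋₊ : ℝ) / M N) atTop (nhds c) := by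
    intro c hc
    have := (tendsto_nat_floor_mul_div_atTop (R := ℝ) hc).comp hMr
    simpa only [Function.comp_def, mul_comm] using this
  have hce : ∀ c : ℝ, 0 ≤ c → Tendsto (fun N => (⌈(M N : ℝ) * c⌉₊ : ℝ) / M N) atTop (nhds c) := by
    intro c hc
    have := (tendsto_nat_ceil_mul_div_atTop (R := ℝ) hc).comp hMr
    simpa only [Function.comp_def, mul_comm] using this
  have hb0 : ∀ i, 0 ≤ b i := fun i => (ha i).trans (hab i).le
  have hout : Tendsto (fun N => ∏ i, ((⌈(M N : ℝ) * b i⌉₊ : ℝ) / M N - (⌊(M N : ℝ) * a i⌋₊ : ℝ) / M N))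
      atTop (nhds (∏ i, (b i - a i))) :=
    tendsto_finsetProd _ fun i _ => (hce _ (hb0 i)).sub (hfl _ (ha i))
  have hinn : Tendsto (fun N => ∏ i, ((⌊(M N : ℝ) * b i⌋₊ : ℝ) / M N - (⌈(M N : ℝ) * a i⌉₊ : ℝ) / M N))
      atTop (nhds (∏ i, (b i - a i))) :=
    tendsto_finsetProd _ fun i _ => (hfl _ (hb0 i)).sub (hce _ (ha i))
  have hpos : ∀ᶠ N in atTop, ∀ i, ⌈(M N : ℝ) * a i⌉₊ ≤ ⌊(M N : ℝ) * b i⌋₊ := by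
    rw [Filter.eventually_all]
    intro i
    filter_upwards [(hce _ (ha i)).eventually_lt (hfl _ (hb0 i)) (hab i), hM.eventually_gt_atTop 0]
      with N h1 h2
    have h2' : (0 : ℝ) < M N := by exact_mod_cast h2
    rw [div_lt_div_iff_of_pos_right h2'] at h1
    exact_mod_cast h1.le
  filter_upwards [hE, hout.eventually (gt_mem_nhds (lt_add_of_pos_right _ hε2)),
    hinn.eventually (lt_mem_nhds (sub_lt_self _ hε2)), hpos, hM.eventually_gt_atTop 0,
    eventually_gt_atTop 0] with N hEN hoN hiN hpN hMN hN
  have hMN' : (0 : ℝ) < M N := by exact_mod_cast hMN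
  have hN' : (0 : ℝ) < N := by exact_mod_cast hN
  set L := M N with hL
  set Tout : Finset (Fin d → ℕ) :=
    Fintype.piFinset (fun i => Finset.Ico ⌊(L : ℝ) * a i⌋₊ ⌈(L : ℝ) * b i⌉₊) with hTo
  set Tin : Finset (Fin d → ℕ) :=
    Fintype.piFinset (fun i => Finset.Ico ⌈(L : ℝ) * a i⌉₊ ⌊(L : ℝ) * b i⌋₊) with hTi
  have hbL : ∀ i, ⌈(L : ℝ) * b i⌉₊ ≤ L := fun i => by
    rw [Nat.ceil_le]; nlinarith [hb i]
  have hfc : ∀ y : ℝ, ⌊y⌋₊ ≤ ⌈y⌉₊ := Nat.floor_le_ceil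
  have hToS : Tout ⊆ grid d L := by
    intro k hk
    simp only [hTo, grid, Fintype.mem_piFinset, Finset.mem_Ico, Finset.mem_range] at hk ⊢
    exact fun i => (hk i).2.trans_le (hbL i)
  have hTiS : Tin ⊆ grid d L := by
    intro k hk
    simp only [hTi, grid, Fintype.mem_piFinset, Finset.mem_Ico, Finset.mem_range] at hk ⊢
    exact fun i => (hk i).2.trans_le ((hfc _).trans (hbL i))
  have ho := union_cells x hx N L hN hMN hε2.le hEN Tout hToS
  have hi := union_cells x hx N L hN hMN hε2.le hEN Tin hTiS
  have hco : (Tout.card : ℝ) / (L : ℝ) ^ d =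
      ∏ i, ((⌈(L : ℝ) * b i⌉₊ : ℝ) / L - (⌊(L : ℝ) * a i⌋₊ : ℝ) / L) := by
    rw [hTo, Fintype.card_piFinset]
    push_cast
    simp only [Nat.card_Ico, ← sub_div]
    rw [Finset.prod_div_distrib, Finset.prod_const, Finset.card_univ, Fintype.card_fin]
    congr 1
    refine Finset.prod_congr rfl fun i _ => ?_
    rw [Nat.cast_sub ((hfc _).trans ((hpN i).trans (hfc _)))]
  have hci : (Tin.card : ℝ) / (L : ℝ) ^ d =
      ∏ i, ((⌊(L : ℝ) * b i⌋₊ : ℝ) / L - (⌈(L : ℝ) * a i⌉₊ : ℝ) / L) := by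
    rw [hTi, Fintype.card_piFinset]
    push_cast
    simp only [Nat.card_Ico, ← sub_div]
    rw [Finset.prod_div_distrib, Finset.prod_const, Finset.card_univ, Fintype.card_fin]
    congr 1
    refine Finset.prod_congr rfl fun i _ => ?_
    rw [Nat.cast_sub (hpN i)]
  rw [hco] at ho
  rw [hci] at hi
  have hup : (((Finset.Icc 1 N).filter (fun n => ∀ i, a i ≤ x n i ∧ x n i < b i)).card : ℝ) / N
      ≤ (((Finset.Icc 1 N).filter (fun n => cell x L n ∈ Tout)).card : ℝ) / N := by
    refine div_le_div_of_nonneg_right ?_ hN'.le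
    norm_cast
    refine Finset.card_le_card (Finset.monotone_filter_right _ fun n _ h => ?_)
    simp only [hTo, Fintype.mem_piFinset, Finset.mem_Ico, cell]
    intro i
    obtain ⟨h1, h2⟩ := h i
    refine ⟨Nat.floor_mono (by gcongr), ?_⟩
    rw [Nat.floor_lt (mul_nonneg hMN'.le (hx n i).1)]
    refine lt_of_lt_of_le ?_ (Nat.le_ceil _)
    gcongr
  have hlow : (((Finset.Icc 1 N).filter (fun n => cell x L n ∈ Tin)).card : ℝ) / N
      ≤ (((Finset.Icc 1 N).filter (fun n => ∀ i, a i ≤ x n i ∧ x n i < b i)).card : ℝ) / N := by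
    refine div_le_div_of_nonneg_right ?_ hN'.le
    norm_cast
    refine Finset.card_le_card (Finset.monotone_filter_right _ fun n _ h => ?_)
    simp only [hTi, Fintype.mem_piFinset, Finset.mem_Ico, cell] at h
    intro i
    obtain ⟨h1, h2⟩ := h i
    constructor
    · have k1 : (L : ℝ) * a i ≤ L * x n i :=
        (Nat.ceil_le.1 h1).trans (Nat.floor_le (mul_nonneg hMN'.le (hx n i).1))
      exact le_of_mul_le_mul_left k1 hMN'
    · have k1 : (L : ℝ) * x n i < L * b i := by
        by_contra hcon
        exact absurd (Nat.floor_mono (not_lt.1 hcon)) (not_le.2 h2)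
      exact lt_of_mul_lt_mul_left k1 hMN'.le
  rw [Real.dist_eq, abs_lt]
  have ho2 := (abs_le.1 ho).2
  have hi1 := (abs_le.1 hi).1
  constructor <;> linarith
end
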